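/- arXiv:1606.04320 — 8 statements merged into one kernel-verified Lean document; each statement's English description precedes it below -/
import Mathlib

section
/- Let 𝒜 be a Grothendieck abelian category. Then the category C(𝒜) of cochain complexes in 𝒜 admits a model structure in which the cofibrations are exactly the monomorphisms and the weak equivalences are exactly the quasi-isomorphisms (the injective model structure). -/
open CategoryTheory CategoryTheory.Limits

universe v u

/-- `f` is a retract of `g` in the arrow category: there are morphisms of arrows
`i : f ⟶ g` and `r : g ⟶ f` with `r ∘ i = id f`. -/
def IsRetractOfMap {C : Type u} [Category.{v} C] {X Y X' Y' : C}
    (f : X ⟶ Y) (g : X' ⟶ Y') : Prop :=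
  ∃ (iX : X ⟶ X') (iY : Y ⟶ Y') (rX : X' ⟶ X) (rY : Y' ⟶ Y),
    iX ≫ rX = 𝟙 X ∧ iY ≫ rY = 𝟙 Y ∧ iX ≫ g = f ≫ iY ∧ rX ≫ f = g ≫ rY

/-- Quillen's model category axioms for three classes of morphisms
(cofibrations, fibrations, weak equivalences) on a category `C`:
two-out-of-three for weak equivalences, closure of the three classes under
retracts, the two lifting axioms, and the two factorization axioms. -/
structure IsModelStructure (C : Type u) [Category.{v} C]
    (Cof Fib W : MorphismProperty C) : Prop where
  weq_comp : ∀ {X Y Z : C} (f : X ⟶ Y) (g : Y ⟶ Z), W f → W g → W (f ≫ g)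
  weq_of_comp_left : ∀ {X Y Z : C} (f : X ⟶ Y) (g : Y ⟶ Z), W f → W (f ≫ g) → W g
  weq_of_comp_right : ∀ {X Y Z : C} (f : X ⟶ Y) (g : Y ⟶ Z), W g → W (f ≫ g) → W f
  cof_retract : ∀ {X Y X' Y' : C} (f : X ⟶ Y) (g : X' ⟶ Y'),
    IsRetractOfMap f g → Cof g → Cof f
  fib_retract : ∀ {X Y X' Y' : C} (f : X ⟶ Y) (g : X' ⟶ Y'),
    IsRetractOfMap f g → Fib g → Fib f
  weq_retract : ∀ {X Y X' Y' : C} (f : X ⟶ Y) (g : X' ⟶ Y'),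
    IsRetractOfMap f g → W g → W f
  lift_cof_trivFib : ∀ {A B X Y : C} (i : A ⟶ B) (p : X ⟶ Y),
    Cof i → Fib p → W p → HasLiftingProperty i p
  lift_trivCof_fib : ∀ {A B X Y : C} (i : A ⟶ B) (p : X ⟶ Y),
    Cof i → W i → Fib p → HasLiftingProperty i p
  fact_cof_trivFib : ∀ {X Y : C} (f : X ⟶ Y),
    ∃ (Z : C) (i : X ⟶ Z) (p : Z ⟶ Y), Cof i ∧ Fib p ∧ W p ∧ i ≫ p = f
  fact_trivCof_fib : ∀ {X Y : C} (f : X ⟶ Y),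
    ∃ (Z : C) (i : X ⟶ Z) (p : Z ⟶ Y), Cof i ∧ W i ∧ Fib p ∧ i ≫ p = f

namespace CategoryTheory

lemma ShortComplex.exact_of_forall_evaluation {J : Type*} [Category* J] {A : Type*} [Category* A]
    [Abelian A] (S : ShortComplex (J ⥤ A)) (h : ∀ j, (S.map ((evaluation J A).obj j)).Exact) :
    S.Exact := by
  rw [ShortComplex.exact_iff_isZero_homology, Functor.isZero_iff]
  intro j
  have := h j
  rw [ShortComplex.exact_iff_isZero_homology] at this
  exact this.of_iso (S.mapHomologyIso ((evaluation J A).obj j)).symm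

end CategoryTheory

section ExactColimits

variable {𝒜 : Type u} [Category.{v} 𝒜] [Abelian 𝒜] {ι : Type*} {cs : ComplexShape ι}

lemma HomologicalComplex.f_comp_toCycles {K L : HomologicalComplex 𝒜 cs} (f : K ⟶ L) (i j : ι) :
    f.f i ≫ L.toCycles i j = K.toCycles i j ≫ HomologicalComplex.cyclesMap f j := by
  simp [← cancel_mono (L.iCycles j)]

variable {J : Type*} [Category* J] [HasColimitsOfShape J 𝒜] [HasExactColimitsOfShape J 𝒜]

/-- The colimit of a diagram of complexes is exact in degree `k` as soon as every homology
class in degree `k` dies at some later stage of the diagram. -/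
lemma HomologicalComplex.exactAt_of_isColimit
    {F : J ⥤ HomologicalComplex 𝒜 cs} {c : Cocone F} (hc : IsColimit c) (k : ι)
    (h : ∀ j, ∃ (j' : J) (φ : j ⟶ j'), HomologicalComplex.homologyMap (F.map φ) k = 0) :
    c.pt.ExactAt k := by
  let S : ShortComplex (J ⥤ 𝒜) := ShortComplex.mk
    (X₁ := F ⋙ HomologicalComplex.cyclesFunctor 𝒜 cs k)
    (X₂ := F ⋙ HomologicalComplex.eval 𝒜 cs k)
    (X₃ := F ⋙ HomologicalComplex.eval 𝒜 cs (cs.next k))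
    { app := fun j => (F.obj j).iCycles k
      naturality := fun _ _ φ => HomologicalComplex.cyclesMap_i (F.map φ) k }
    { app := fun j => (F.obj j).d k _
      naturality := fun _ _ φ => (F.map φ).comm _ _ }
    (by ext j; exact (F.obj j).iCycles_d k _)
  have hS : S.Exact := by
    apply ShortComplex.exact_of_forall_evaluation
    intro j
    exact ShortComplex.exact_of_f_is_kernel _ ((F.obj j).cyclesIsKernel k _ rfl)
  let c₁ : Cocone S.X₁ := colimit.cocone _
  have hc₁ : IsColimit c₁ := colimit.isColimit _
  have hc₀ := isColimitOfPreserves (HomologicalComplex.eval 𝒜 cs (cs.prev k)) hc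
  have hc₂ := isColimitOfPreserves (HomologicalComplex.eval 𝒜 cs k) hc
  have hc₃ := isColimitOfPreserves (HomologicalComplex.eval 𝒜 cs (cs.next k)) hc
  let c₂' : Cocone S.X₂ := (HomologicalComplex.eval 𝒜 cs k).mapCocone c
  let f : c₁.pt ⟶ c.pt.X k := hc₁.desc (Cocone.mk (c.pt.X k)
    (S.f ≫ c₂'.ι))
  have hf (j : J) : c₁.ι.app j ≫ f = S.f.app j ≫ c₂'.ι.app j := by
    exact hc₁.fac _ j
  have hg (j : J) : (c.ι.app j).f k ≫ c.pt.d k (cs.next k) =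
      S.g.app j ≫ (c.ι.app j).f (cs.next k) := (c.ι.app j).comm _ _
  have ex := colim.exact_mapShortComplex hS hc₁ hc₂ hc₃ f (c.pt.d k _) hf hg
  let Z : 𝒜 := c₁.pt
  let inc (j : J) : (F.obj j).cycles k ⟶ Z := c₁.ι.app j
  have inc_w {j j' : J} (φ : j ⟶ j') :
      HomologicalComplex.cyclesMap (F.map φ) k ≫ inc j' = inc j := c₁.w φ
  have inc_f (j : J) : inc j ≫ f = (F.obj j).iCycles k ≫ (c.ι.app j).f k := hf j
  have inc_ext {W : 𝒜} {a b : Z ⟶ W} (hab : ∀ j, inc j ≫ a = inc j ≫ b) : a = b :=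
    hc₁.hom_ext hab
  let t : c.pt.X (cs.prev k) ⟶ Z := hc₀.desc (Cocone.mk Z
    { app := fun j => (F.obj j).toCycles (cs.prev k) k ≫ inc j
      naturality := fun j j' φ => by
        refine Eq.trans ?_ (Category.comp_id _).symm
        rw [← inc_w φ]
        exact (Category.assoc _ _ _).symm.trans
          ((HomologicalComplex.f_comp_toCycles (F.map φ) _ _ =≫ inc j').trans
            (Category.assoc _ _ _)) })
  have ht (j : J) : (c.ι.app j).f (cs.prev k) ≫ t = (F.obj j).toCycles (cs.prev k) k ≫ inc j :=
    hc₀.fac _ j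
  have htf : t ≫ f = c.pt.d _ k := hc₀.hom_ext (fun j => by
    change (c.ι.app j).f (cs.prev k) ≫ t ≫ f = (c.ι.app j).f (cs.prev k) ≫ c.pt.d _ k
    rw [reassoc_of% (ht j), inc_f, HomologicalComplex.toCycles_i_assoc]
    exact ((c.ι.app j).comm _ _).symm)
  have : Epi t := by
    rw [Preadditive.epi_iff_cancel_zero]
    intro W g hg
    apply inc_ext
    intro j
    have hz (j : J) : (F.obj j).toCycles (cs.prev k) k ≫ inc j ≫ g = 0 := by
      rw [← reassoc_of% (ht j), hg, comp_zero]
    obtain ⟨j', φ, hφ⟩ := h j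
    obtain ⟨e, he⟩ : ∃ e, (F.obj j').homologyπ k ≫ e = inc j' ≫ g :=
      ⟨_, ((F.obj j').homologyIsCokernel _ k rfl).fac (CokernelCofork.ofπ _ (hz j'))
        WalkingParallelPair.one⟩
    rw [comp_zero, ← inc_w φ, Category.assoc, ← he,
      ← HomologicalComplex.homologyπ_naturality_assoc, hφ, zero_comp, comp_zero]
  let τ : c.pt.sc k ⟶ colim.mapShortComplex S hc₁ ((HomologicalComplex.eval 𝒜 cs k).mapCocone c)
      ((HomologicalComplex.eval 𝒜 cs (cs.next k)).mapCocone c) f (c.pt.d k _) hf hg :=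
    { τ₁ := t
      τ₂ := 𝟙 _
      τ₃ := 𝟙 _
      comm₁₂ := by
        refine Eq.trans htf ?_
        exact (Category.comp_id _).symm
      comm₂₃ := by
        refine (Category.id_comp _).trans (Category.comp_id _).symm }
  have : Epi τ.τ₁ := this
  have : IsIso τ.τ₂ := inferInstanceAs (IsIso (𝟙 _))
  have : Mono τ.τ₃ := inferInstanceAs (Mono (𝟙 _))
  exact (ShortComplex.exact_iff_of_epi_of_isIso_of_mono τ).2 ex

lemma HomologicalComplex.acyclic_of_isColimit
    {F : J ⥤ HomologicalComplex 𝒜 cs} {c : Cocone F} (hc : IsColimit c)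
    (h : ∀ j, (F.obj j).Acyclic) : c.pt.Acyclic := fun k =>
  exactAt_of_isColimit hc k (fun j => ⟨j, 𝟙 _,
    (((HomologicalComplex.exactAt_iff_isZero_homology _ _).1 (h j k)).eq_of_src _ _)⟩)

end ExactColimits

namespace CochainComplex
variable {𝒜 : Type u} [Category.{v} 𝒜] [Abelian 𝒜]

lemma homology_isZero {K : CochainComplex 𝒜 ℤ} (hK : K.Acyclic) (n : ℤ) : IsZero (K.homology n) :=
  (HomologicalComplex.exactAt_iff_isZero_homology _ _).1 (hK n)

lemma quasiIso_f_of_shortExact {S : ShortComplex (CochainComplex 𝒜 ℤ)} (hS : S.ShortExact)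
    (h : S.X₃.Acyclic) : QuasiIso S.f := by
  rw [quasiIso_iff]
  intro n
  rw [quasiIsoAt_iff_isIso_homologyMap]
  have : Mono (HomologicalComplex.homologyMap S.f n) :=
    (hS.homology_exact₁ (n - 1) n (by simp)).mono_g ((homology_isZero h _).eq_of_src _ _)
  have : Epi (HomologicalComplex.homologyMap S.f n) :=
    (hS.homology_exact₂ n).epi_f ((homology_isZero h _).eq_of_tgt _ _)
  exact isIso_of_mono_of_epi _

lemma quasiIso_g_of_shortExact {S : ShortComplex (CochainComplex 𝒜 ℤ)} (hS : S.ShortExact)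
    (h : S.X₁.Acyclic) : QuasiIso S.g := by
  rw [quasiIso_iff]
  intro n
  rw [quasiIsoAt_iff_isIso_homologyMap]
  have : Mono (HomologicalComplex.homologyMap S.g n) :=
    (hS.homology_exact₂ n).mono_g ((homology_isZero h _).eq_of_src _ _)
  have : Epi (HomologicalComplex.homologyMap S.g n) :=
    (hS.homology_exact₃ n (n + 1) (by simp)).epi_f ((homology_isZero h _).eq_of_tgt _ _)
  exact isIso_of_mono_of_epi _

lemma shortExact_cokernel {K L : CochainComplex 𝒜 ℤ} (f : K ⟶ L) [Mono f] :
    (ShortComplex.mk f (cokernel.π f) (cokernel.condition f)).ShortExact where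
  exact := ShortComplex.exact_of_g_is_cokernel _ (cokernelIsCokernel f)
  mono_f := ‹_›
  epi_g := inferInstanceAs (Epi (cokernel.π f))

lemma shortExact_kernel {K L : CochainComplex 𝒜 ℤ} (f : K ⟶ L) [Epi f] :
    (ShortComplex.mk (kernel.ι f) f (kernel.condition f)).ShortExact where
  exact := ShortComplex.exact_of_f_is_kernel _ (kernelIsKernel f)
  mono_f := inferInstanceAs (Mono (kernel.ι f))
  epi_g := ‹_›

lemma quasiIso_iff_acyclic_cokernel {K L : CochainComplex 𝒜 ℤ} (f : K ⟶ L) [Mono f] :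
    QuasiIso f ↔ (cokernel f).Acyclic :=
  ⟨fun h => (shortExact_cokernel f).acyclic_X₃ h, quasiIso_f_of_shortExact (shortExact_cokernel f)⟩

lemma quasiIso_of_acyclic_kernel {K L : CochainComplex 𝒜 ℤ} (f : K ⟶ L) [Epi f]
    (h : (kernel f).Acyclic) : QuasiIso f :=
  quasiIso_g_of_shortExact (shortExact_kernel f) h

lemma Acyclic.of_iso {K L : CochainComplex 𝒜 ℤ} (e : K ≅ L) (h : K.Acyclic) : L.Acyclic := by
  intro n
  rw [HomologicalComplex.exactAt_iff_isZero_homology]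
  exact (homology_isZero h n).of_iso ((HomologicalComplex.homologyFunctor 𝒜 _ n).mapIso e.symm)

lemma Acyclic.of_retract {K L : CochainComplex 𝒜 ℤ} (i : K ⟶ L) (r : L ⟶ K) (hir : i ≫ r = 𝟙 K)
    (h : L.Acyclic) : K.Acyclic := by
  intro n
  rw [HomologicalComplex.exactAt_iff_isZero_homology]
  have := congr_arg (fun f => HomologicalComplex.homologyMap f n) hir
  simp only [HomologicalComplex.homologyMap_comp, HomologicalComplex.homologyMap_id] at this
  rw [IsZero.iff_id_eq_zero, ← this, (homology_isZero h n).eq_of_src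
    (HomologicalComplex.homologyMap r n) 0, comp_zero]

lemma acyclic_mappingCone_id (K : CochainComplex 𝒜 ℤ) : (mappingCone (𝟙 K)).Acyclic := fun n => by
  rw [HomologicalComplex.exactAt_iff_isZero_homology, IsZero.iff_id_eq_zero,
    ← HomologicalComplex.homologyMap_id, (mappingCone.homotopyToZeroOfId K).homologyMap_eq,
    HomologicalComplex.homologyMap_zero]

lemma mono_mappingCone_inr {K L : CochainComplex 𝒜 ℤ} (φ : K ⟶ L) : Mono (mappingCone.inr φ) :=
  HomologicalComplex.mono_of_mono_f _ (fun n => mono_of_mono_fac (mappingCone.inr_f_snd_v φ n))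

variable (𝒜) in
/-- The class of monomorphisms of cochain complexes that are quasi-isomorphisms. -/
abbrev trivialCofibrations : MorphismProperty (CochainComplex 𝒜 ℤ) :=
  MorphismProperty.monomorphisms _ ⊓ HomologicalComplex.quasiIso 𝒜 (ComplexShape.up ℤ)

instance : (trivialCofibrations 𝒜).IsStableUnderCobaseChange where
  of_isPushout {A A' B B' f g f' g'} sq hf := by
    have : Mono f := hf.1
    have : QuasiIso f := hf.2
    have : Mono f' := MorphismProperty.IsStableUnderCobaseChange.of_isPushout
      (P := MorphismProperty.monomorphisms _) sq ‹Mono f›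
    refine ⟨this, (quasiIso_iff_acyclic_cokernel f').2 ?_⟩
    have := isIso_cokernel_map_of_isPushout sq.flip
    exact Acyclic.of_iso (asIso (cokernel.map _ _ _ _ sq.flip.w))
      ((quasiIso_iff_acyclic_cokernel f).1 ‹_›)

variable {J : Type*} [Category* J]

/-- The functor of pointwise cokernels of a natural transformation. -/
@[simps]
noncomputable def cokernelFunctor {C : Type*} [Category* C] [Abelian C] {X₁ X₂ : J ⥤ C}
    (f : X₁ ⟶ X₂) : J ⥤ C where
  obj j := cokernel (f.app j)
  map φ := cokernel.map _ _ (X₁.map φ) (X₂.map φ) (f.naturality φ).symm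

/-- The cocone on pointwise cokernels induced by a morphism between cocones. -/
@[simps]
noncomputable def cokernelCocone {C : Type*} [Category* C] [Abelian C] {X₁ X₂ : J ⥤ C}
    (f : X₁ ⟶ X₂) (c₁ : Cocone X₁) (c₂ : Cocone X₂) (φ : c₁.pt ⟶ c₂.pt)
    (hφ : ∀ j, c₁.ι.app j ≫ φ = f.app j ≫ c₂.ι.app j) : Cocone (cokernelFunctor f) where
  pt := cokernel φ
  ι :=
    { app := fun j => cokernel.map _ _ _ _ (hφ j).symm
      naturality := fun j j' ψ => by
        refine Eq.trans ?_ (Category.comp_id _).symm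
        refine (cancel_epi (cokernel.π (f.app j))).1 ?_
        dsimp only [cokernelFunctor]
        have h := c₂.w ψ
        rw [cokernel.π_desc_assoc, Category.assoc, cokernel.π_desc, cokernel.π_desc, ← h,
          Category.assoc] }

/-- Cokernels commute with colimits. -/
noncomputable def isColimitCokernelCocone {C : Type*} [Category* C] [Abelian C] {X₁ X₂ : J ⥤ C}
    (f : X₁ ⟶ X₂) {c₁ : Cocone X₁} {c₂ : Cocone X₂} (hc₁ : IsColimit c₁) (hc₂ : IsColimit c₂)
    (φ : c₁.pt ⟶ c₂.pt) (hφ : ∀ j, c₁.ι.app j ≫ φ = f.app j ≫ c₂.ι.app j) :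
    IsColimit (cokernelCocone f c₁ c₂ φ hφ) where
  desc s := cokernel.desc _ (hc₂.desc (Cocone.mk s.pt
    { app := fun j => cokernel.π (f.app j) ≫ s.ι.app j
      naturality := fun j j' ψ => by
        refine Eq.trans ?_ (Category.comp_id _).symm
        have h : cokernel.map _ _ _ _ (f.naturality ψ).symm ≫ s.ι.app j' = s.ι.app j := s.w ψ
        rw [← h]
        exact (cokernel.π_desc_assoc _ _ _ _).trans (Category.assoc _ _ _) |>.symm }))
    (hc₁.hom_ext (fun j => by
      rw [reassoc_of% (hφ j), hc₂.fac, comp_zero]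
      exact cokernel.condition_assoc _ _ |>.trans zero_comp))
  fac s j := by
    refine (cancel_epi (cokernel.π (f.app j))).1 ?_
    refine (cokernel.π_desc_assoc _ _ _ _).trans ((Category.assoc _ _ _).trans ?_)
    refine (congr_arg (c₂.ι.app j ≫ ·) (cokernel.π_desc _ _ _)).trans ?_
    exact hc₂.fac _ j
  uniq s m hm := by
    refine (cancel_epi (cokernel.π φ)).1 ?_
    refine hc₂.hom_ext (fun j => ?_)
    rw [cokernel.π_desc, hc₂.fac]
    have h : cokernel.map _ _ _ _ (hφ j).symm ≫ m = s.ι.app j := hm j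
    refine Eq.trans ?_ (congr_arg (cokernel.π (f.app j) ≫ ·) h)
    exact ((cokernel.π_desc_assoc _ _ _ _).trans (Category.assoc _ _ _)).symm

variable [HasColimitsOfShape J 𝒜] [HasExactColimitsOfShape J 𝒜]

instance : (trivialCofibrations 𝒜).IsStableUnderColimitsOfShape J where
  condition X₁ X₂ c₁ c₂ hc₁ hc₂ f hf φ hφ := by
    have : Mono φ := MorphismProperty.IsStableUnderColimitsOfShape.condition
      (W := MorphismProperty.monomorphisms _) X₁ X₂ c₁ c₂ hc₁ hc₂ f (fun j => (hf j).1) φ hφ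
    refine ⟨this, (quasiIso_iff_acyclic_cokernel φ).2 ?_⟩
    refine HomologicalComplex.acyclic_of_isColimit (c := cokernelCocone f c₁ c₂ φ hφ)
      (isColimitCokernelCocone f hc₁ hc₂ φ hφ) (fun j => ?_)
    have : Mono (f.app j) := (hf j).1
    exact (quasiIso_iff_acyclic_cokernel (f.app j)).1 (hf j).2

instance [HasCoproducts.{v} 𝒜] [AB4OfSize.{v} 𝒜] :
    MorphismProperty.IsStableUnderCoproducts.{v} (trivialCofibrations 𝒜) where

instance [HasFilteredColimitsOfSize.{v, v} 𝒜] [AB5OfSize.{v, v} 𝒜] :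
    MorphismProperty.IsStableUnderFilteredColimits.{v, v} (trivialCofibrations 𝒜) where
  isStableUnderColimitsOfShape J _ _ := by infer_instance

instance [HasFilteredColimitsOfSize.{v, v} 𝒜] [AB5OfSize.{v, v} 𝒜] :
    MorphismProperty.IsStableUnderTransfiniteComposition.{v} (trivialCofibrations 𝒜) :=
  inferInstance

end CochainComplex

namespace CochainComplex
variable {𝒜 : Type u} [Category.{v} 𝒜] [Abelian 𝒜]

lemma exists_universal_hom_f (X : 𝒜) (n : ℤ) :
    ∃ (D : CochainComplex 𝒜 ℤ) (δ : X ⟶ D.X n), ∀ (Q : CochainComplex 𝒜 ℤ) (t : X ⟶ Q.X n),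
      ∃ φ : D ⟶ Q, δ ≫ φ.f n = t := by
  let e := HomologicalComplex.evalCompCoyonedaCorepresentable (ComplexShape.up ℤ) X n
  refine ⟨_, e.homEquiv (𝟙 _), fun Q t => ⟨e.homEquiv.symm t, ?_⟩⟩
  exact (e.homEquiv_eq _).symm.trans (e.homEquiv.apply_symm_apply t)

lemma epi_toCycles {K : CochainComplex 𝒜 ℤ} (hK : K.Acyclic) {i j : ℤ} (h : i + 1 = j) :
    Epi (K.toCycles i j) := by
  have h : (ComplexShape.up ℤ).prev j = i := by simp [← h]
  subst h
  exact (hK j).epi_toCycles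

variable [IsGrothendieckAbelian.{v} 𝒜]

open scoped Classical in
/-- Any complex `P` maps to a complex `P'` such that any morphism from `P` to an acyclic complex
extends to `P'` in such a way that the inclusion of the images vanishes in homology. -/
lemma exists_extension_homologyMap_eq_zero (P : CochainComplex 𝒜 ℤ) :
    ∃ (P' : CochainComplex 𝒜 ℤ), ∀ {Q : CochainComplex 𝒜 ℤ} (_ : Q.Acyclic) (u : P ⟶ Q),
      ∃ (u' : P' ⟶ Q) (h : imageSubobject u ≤ imageSubobject u'),
        ∀ k, HomologicalComplex.homologyMap (Subobject.ofLE _ _ h) k = 0 := by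
  obtain ⟨G, hG⟩ : ∃ G : 𝒜, IsSeparator G := ⟨_, isSeparator_separator 𝒜⟩
  choose D δ hδ using fun n => exists_universal_hom_f G n
  let F : (Σ k : ℤ, G ⟶ P.X k) → CochainComplex 𝒜 ℤ := fun x => D (x.1 - 1)
  refine ⟨P ⨿ ∐ F, fun {Q} hQ u => ?_⟩
  have hw (x : Σ k : ℤ, G ⟶ P.X k) : ∃ w : F x ⟶ Q,
      (∃ t : G ⟶ Q.X (x.1 - 1), t ≫ Q.d _ x.1 = x.2 ≫ u.f x.1) →
        (δ (x.1 - 1) ≫ w.f (x.1 - 1)) ≫ Q.d _ x.1 = x.2 ≫ u.f x.1 := by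
    by_cases h : ∃ t : G ⟶ Q.X (x.1 - 1), t ≫ Q.d _ x.1 = x.2 ≫ u.f x.1
    · obtain ⟨t, ht⟩ := h
      obtain ⟨w, hw⟩ := hδ _ Q t
      exact ⟨w, fun _ => by rw [hw, ht]⟩
    · exact ⟨0, fun h' => (h h').elim⟩
  choose w hw using hw
  let u' : P ⨿ ∐ F ⟶ Q := coprod.desc u (Limits.Sigma.desc w)
  have hle : imageSubobject u ≤ imageSubobject u' := by
    have h : coprod.inl ≫ u' = u := coprod.inl_desc _ _
    exact h ▸ imageSubobject_comp_le _ _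
  refine ⟨u', hle, fun k => ?_⟩
  let p := factorThruImageSubobject u
  let p' := factorThruImageSubobject u'
  let i := (imageSubobject u).arrow
  let i' := (imageSubobject u').arrow
  let j := Subobject.ofLE _ _ hle
  have hpi : p ≫ i = u := imageSubobject_arrow_comp u
  have hpi' : p' ≫ i' = u' := imageSubobject_arrow_comp u'
  have hj : j ≫ i' = i := Subobject.ofLE_arrow _
  have : Mono (i'.f k) := inferInstanceAs (Mono ((HomologicalComplex.eval _ _ k).map i'))
  have : Epi (p.f k) := inferInstanceAs (Epi ((HomologicalComplex.eval _ _ k).map p))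
  have := epi_toCycles hQ (sub_add_cancel k 1)
  change HomologicalComplex.homologyMap j k = 0
  rw [← cancel_epi (HomologicalComplex.homologyπ _ k),
    HomologicalComplex.homologyπ_naturality, comp_zero]
  let a := pullback.fst (p.f k) (HomologicalComplex.iCycles _ k)
  let b := pullback.snd (p.f k) (HomologicalComplex.iCycles _ k)
  have hab : a ≫ p.f k = b ≫ HomologicalComplex.iCycles _ k := pullback.condition
  let c := pullback.fst (b ≫ HomologicalComplex.cyclesMap i k) (Q.toCycles (k - 1) k)
  let d := pullback.snd (b ≫ HomologicalComplex.cyclesMap i k) (Q.toCycles (k - 1) k)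
  have hcd : c ≫ b ≫ HomologicalComplex.cyclesMap i k = d ≫ Q.toCycles (k - 1) k :=
    pullback.condition
  rw [← cancel_epi (c ≫ b), comp_zero]
  refine hG.def _ _ (fun g => ?_)
  rw [comp_zero]
  have h₁ : (g ≫ d) ≫ Q.d _ k = (g ≫ c ≫ a) ≫ u.f k := by
    have := (g ≫= hcd) =≫ Q.iCycles k
    simp only [Category.assoc, HomologicalComplex.toCycles_i, HomologicalComplex.cyclesMap_i] at this
    have hpif : p.f k ≫ i.f k = u.f k := by rw [← HomologicalComplex.comp_f, hpi]
    rw [Category.assoc, ← this, ← hpif]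
    simp only [Category.assoc, reassoc_of% hab]
  have h₂ := hw ⟨k, g ≫ c ≫ a⟩ ⟨_, h₁⟩
  dsimp only at h₂
  have h₃ : w ⟨k, g ≫ c ≫ a⟩ = (Limits.Sigma.ι F ⟨k, g ≫ c ≫ a⟩ ≫ coprod.inr ≫ p') ≫ i' := by
    rw [Category.assoc, Category.assoc, hpi']
    have h : coprod.inr ≫ u' = Limits.Sigma.desc w := coprod.inr_desc _ _
    rw [h]
    exact (Limits.Sigma.ι_desc _ _).symm
  generalize (Limits.Sigma.ι F ⟨k, g ≫ c ≫ a⟩ ≫ coprod.inr ≫ p') = q at h₃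
  have h₄ : (g ≫ c ≫ b) ≫ HomologicalComplex.cyclesMap j k =
      (δ (k - 1) ≫ q.f (k - 1)) ≫ HomologicalComplex.toCycles _ (k - 1) k := by
    rw [← cancel_mono (HomologicalComplex.iCycles _ k), ← cancel_mono (i'.f k)]
    simp only [Category.assoc, HomologicalComplex.toCycles_i, HomologicalComplex.cyclesMap_i]
    rw [← HomologicalComplex.comp_f, hj, ← reassoc_of% hab, ← HomologicalComplex.comp_f, hpi]
    simp only [Category.assoc, h₃, HomologicalComplex.comp_f] at h₂
    simp only [HomologicalComplex.Hom.comm] at h₂ ⊢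
    exact h₂.symm
  have := h₄ =≫ HomologicalComplex.homologyπ _ k
  simpa using this

end CochainComplex

namespace CategoryTheory.Subobject
variable {C : Type*} [Category.{v} C] {X : C} {J : Type*} [Preorder J]

/-- The diagram attached to a monotone family of subobjects. -/
@[simps]
noncomputable def functorOfMonotone {I : J → Subobject X} (hI : Monotone I) : J ⥤ C where
  obj j := (I j : C)
  map f := Subobject.ofLE _ _ (hI (leOfHom f))

/-- The cocone attached to an upper bound of a monotone family of subobjects. -/
@[simps]
noncomputable def coconeOfMonotone {I : J → Subobject X} (hI : Monotone I) {A : Subobject X}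
    (hA : ∀ j, I j ≤ A) : Cocone (functorOfMonotone hI) where
  pt := (A : C)
  ι :=
    { app j := Subobject.ofLE _ _ (hA j)
      naturality _ _ _ := (Subobject.ofLE_comp_ofLE _ _ _ _ _).trans (Category.comp_id _).symm }

/-- In a Grothendieck abelian category, the supremum of a directed family of subobjects is
its colimit. -/
lemma nonempty_isColimit_coconeOfMonotone {C : Type*} [Category.{v} C] {X : C} {J : Type v}
    [PartialOrder J] [Abelian C]
    [IsGrothendieckAbelian.{v} C] [IsFiltered J] {I : J → Subobject X} (hI : Monotone I)
    {A : Subobject X} (hA : ∀ j, I j ≤ A) (h : A = ⨆ j, I j) :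
    Nonempty (IsColimit (coconeOfMonotone hI hA)) := by
  let F : J ⥤ MonoOver X :=
    { obj j := MonoOver.mk (I j).arrow
      map f := MonoOver.homMk (Subobject.ofLE _ _ (hI (leOfHom f))) }
  let c : Cocone (F ⋙ MonoOver.forget X) :=
    { pt := Over.mk A.arrow
      ι :=
        { app j := Over.homMk (Subobject.ofLE _ _ (hA j)) (Subobject.ofLE_arrow _)
          naturality _ _ _ := by
            ext
            exact (Subobject.ofLE_comp_ofLE _ _ _ _ _).trans (Category.comp_id _).symm } }
  have : Mono c.pt.hom := inferInstanceAs (Mono A.arrow)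
  exact ⟨IsGrothendieckAbelian.isColimitMapCoconeOfSubobjectMkEqISup F c (by
    dsimp [c, F]
    simp only [Subobject.mk_arrow]
    exact h)⟩

end CategoryTheory.Subobject

namespace CategoryTheory.IsGrothendieckAbelian

lemma imageSubobject_sigmaDesc {C : Type*} [Category.{v} C] [Abelian C] [IsGrothendieckAbelian.{v} C]
    {J : Type v} {P : J → C} {X : C} (u : ∀ j, P j ⟶ X) :
    imageSubobject (Limits.Sigma.desc u) = ⨆ j, imageSubobject (u j) := by
  apply le_antisymm
  · refine imageSubobject_le _ (Limits.Sigma.desc (fun j => factorThruImageSubobject (u j) ≫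
      Subobject.ofLE _ _ (le_iSup (fun j => imageSubobject (u j)) j))) ?_
    refine Limits.Sigma.hom_ext _ _ (fun j => ?_)
    rw [Limits.Sigma.ι_desc_assoc, Category.assoc, Subobject.ofLE_arrow, imageSubobject_arrow_comp,
      Limits.Sigma.ι_desc]
  · refine iSup_le (fun j => ?_)
    have h : Limits.Sigma.ι P j ≫ Limits.Sigma.desc u = u j := Limits.Sigma.ι_desc _ _
    exact h ▸ imageSubobject_comp_le _ _

end CategoryTheory.IsGrothendieckAbelian

namespace CochainComplex
variable {𝒜 : Type u} [Category.{v} 𝒜] [Abelian 𝒜] [IsGrothendieckAbelian.{v} 𝒜]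

/-- Any morphism from `P₀` to an acyclic complex extends to a morphism with acyclic image
from a complex `P` which depends only on `P₀`. -/
lemma exists_extension_acyclic_imageSubobject (P₀ : CochainComplex 𝒜 ℤ) :
    ∃ (P : CochainComplex 𝒜 ℤ), ∀ {Q : CochainComplex 𝒜 ℤ} (_ : Q.Acyclic) (u₀ : P₀ ⟶ Q),
      ∃ u : P ⟶ Q, imageSubobject u₀ ≤ imageSubobject u ∧
        HomologicalComplex.Acyclic (imageSubobject u : CochainComplex 𝒜 ℤ) := by
  choose next ext hle hzero using exists_extension_homologyMap_eq_zero (𝒜 := 𝒜)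
  let P : ℕ → CochainComplex 𝒜 ℤ := fun n =>
    Nat.rec (motive := fun _ => CochainComplex 𝒜 ℤ) P₀ (fun _ P => next P) n
  refine ⟨∐ fun n : ULift.{v} ℕ => P n.down, fun {Q} hQ u₀ => ?_⟩
  let u : ∀ n : ℕ, P n ⟶ Q := fun n =>
    Nat.rec (motive := fun n => P n ⟶ Q) u₀ (fun n u => ext (P n) hQ u) n
  have hmono : Monotone (fun n : ℕ => (imageSubobject (u n) : Subobject Q)) :=
    monotone_nat_of_le_succ (fun n => hle (P n) hQ (u n))
  have hmono' : Monotone (fun n : ULift.{v} ℕ => imageSubobject (u n.down)) :=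
    fun _ _ h => hmono h
  have himage := IsGrothendieckAbelian.imageSubobject_sigmaDesc (fun n : ULift.{v} ℕ => u n.down)
  have hub (n : ULift.{v} ℕ) : imageSubobject (u n.down) ≤
      imageSubobject (Limits.Sigma.desc fun n : ULift.{v} ℕ => u n.down) :=
    himage.symm ▸ le_iSup (fun n : ULift.{v} ℕ => imageSubobject (u n.down)) n
  refine ⟨Limits.Sigma.desc fun n => u n.down, hub ⟨0⟩, fun k => ?_⟩
  obtain ⟨hc⟩ := Subobject.nonempty_isColimit_coconeOfMonotone hmono' hub himage
  exact HomologicalComplex.exactAt_of_isColimit hc k (fun n =>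
    ⟨⟨n.down + 1⟩, homOfLE (Nat.le_succ n.down), hzero (P n.down) hQ (u n.down) k⟩)

end CochainComplex

namespace CategoryTheory.IsGrothendieckAbelian

lemma exists_lift_imageSubobject_eq {C : Type*} [Category.{v} C] [Abelian C]
    [IsGrothendieckAbelian.{v} C] (P : C) :
    ∃ P' : C, ∀ {B Q : C} (g : B ⟶ Q) [Epi g] (u : P ⟶ Q), ∃ f : P' ⟶ B,
      imageSubobject (f ≫ g) = imageSubobject u := by
  classical
  obtain ⟨S, hS⟩ : ∃ S : C, IsSeparator S := ⟨_, isSeparator_separator C⟩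
  refine ⟨∐ fun _ : S ⟶ P => S, fun {B Q} g _ u => ?_⟩
  have hw (h : S ⟶ P) : ∃ w : S ⟶ B, ((∃ t : S ⟶ B, t ≫ g = h ≫ u) → w ≫ g = h ≫ u) ∧
      imageSubobject (w ≫ g) ≤ imageSubobject u := by
    by_cases ht : ∃ t : S ⟶ B, t ≫ g = h ≫ u
    · obtain ⟨t, ht⟩ := ht
      exact ⟨t, fun _ => ht, by rw [ht]; exact imageSubobject_comp_le _ _⟩
    · exact ⟨0, fun h' => (ht h').elim, by rw [zero_comp, imageSubobject_zero]; exact bot_le⟩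
  choose w hw hw' using hw
  refine ⟨Limits.Sigma.desc w, le_antisymm ?_ ?_⟩
  · have : Limits.Sigma.desc w ≫ g = Limits.Sigma.desc (fun h => w h ≫ g) :=
      Limits.Sigma.hom_ext _ _ (fun h => by
        rw [Limits.Sigma.ι_desc_assoc, Limits.Sigma.ι_desc])
    rw [this, imageSubobject_sigmaDesc]
    exact iSup_le hw'
  · let I := imageSubobject (Limits.Sigma.desc w ≫ g)
    have hI (h : S ⟶ P) : (w h ≫ g) ≫ cokernel.π I.arrow = 0 := by
      have h₁ : w h ≫ g = Limits.Sigma.ι (fun _ : S ⟶ P => S) h ≫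
          factorThruImageSubobject (Limits.Sigma.desc w ≫ g) ≫ I.arrow := by
        rw [imageSubobject_arrow_comp, Limits.Sigma.ι_desc_assoc]
      rw [h₁, Category.assoc, Category.assoc, cokernel.condition, comp_zero, comp_zero]
    have h₀ : u ≫ cokernel.π I.arrow = 0 := by
      rw [← cancel_epi (pullback.fst u g), comp_zero]
      refine hS.def _ _ (fun s => ?_)
      rw [comp_zero]
      have hs : (s ≫ pullback.fst u g) ≫ u = (s ≫ pullback.snd u g) ≫ g := by
        rw [Category.assoc, Category.assoc, pullback.condition]
      have := hI (s ≫ pullback.fst u g)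
      rw [hw _ ⟨_, hs.symm⟩] at this
      simpa only [Category.assoc] using this
    exact imageSubobject_le _ (Abelian.monoLift I.arrow u h₀) (Abelian.monoLift_comp _ _ _)

end CategoryTheory.IsGrothendieckAbelian

namespace CochainComplex
variable {𝒜 : Type u} [Category.{v} 𝒜] [Abelian 𝒜]

/-- The trivial cofibrations which are inclusions of subobjects of `P`. -/
def trivialCofibrationsTo (P : CochainComplex 𝒜 ℤ) : MorphismProperty (CochainComplex 𝒜 ℤ) :=
  MorphismProperty.ofHoms (fun X : { X : Subobject P // QuasiIso X.arrow } => X.1.arrow)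

lemma trivialCofibrationsTo_arrow {P : CochainComplex 𝒜 ℤ} (X : Subobject P)
    (hX : QuasiIso X.arrow) : trivialCofibrationsTo P X.arrow :=
  MorphismProperty.ofHoms.mk (f := fun X : { X : Subobject P // QuasiIso X.arrow } => X.1.arrow)
    ⟨X, hX⟩

lemma trivialCofibrationsTo_le (P : CochainComplex 𝒜 ℤ) :
    trivialCofibrationsTo P ≤ trivialCofibrations 𝒜 := by
  rintro _ _ _ ⟨X⟩
  exact ⟨inferInstanceAs (Mono X.1.arrow), X.2⟩

lemma trivialCofibrationsTo_pushouts_le (P : CochainComplex 𝒜 ℤ) :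
    (trivialCofibrationsTo P).pushouts ≤ trivialCofibrations 𝒜 := by
  rw [MorphismProperty.pushouts_le_iff]
  exact trivialCofibrationsTo_le P

/-- The complex `P` detects nonzero acyclic quotients: if `g : B ⟶ Q` is an epimorphism to a
nonzero acyclic complex, there is a morphism `P ⟶ B` whose composition with `g` is nonzero and
has acyclic image. -/
def DetectsAcyclicQuotients (P : CochainComplex 𝒜 ℤ) : Prop :=
  ∀ {B Q : CochainComplex 𝒜 ℤ} (g : B ⟶ Q) [Epi g] (_ : Q.Acyclic) (_ : ¬ IsZero Q),
    ∃ f : P ⟶ B, f ≫ g ≠ 0 ∧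
      HomologicalComplex.Acyclic (imageSubobject (f ≫ g) : CochainComplex 𝒜 ℤ)

variable [IsGrothendieckAbelian.{v} 𝒜]

variable (𝒜) in
lemma exists_detectsAcyclicQuotients :
    ∃ P : CochainComplex 𝒜 ℤ, DetectsAcyclicQuotients P := by
  obtain ⟨S, hS⟩ : ∃ S : CochainComplex 𝒜 ℤ, IsSeparator S := ⟨_, isSeparator_separator _⟩
  obtain ⟨P₁, hP₁⟩ := exists_extension_acyclic_imageSubobject S
  obtain ⟨P, hP⟩ := IsGrothendieckAbelian.exists_lift_imageSubobject_eq P₁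
  refine ⟨P, fun {B Q} g _ hQ hQ' => ?_⟩
  obtain ⟨u₀, hu₀⟩ : ∃ u₀ : S ⟶ Q, u₀ ≠ 0 := by
    by_contra! h
    exact hQ' ((IsZero.iff_id_eq_zero _).2 (hS.def _ _ (fun s => by rw [h (s ≫ _), h (s ≫ _)])))
  obtain ⟨u, hu, hu'⟩ := hP₁ hQ u₀
  obtain ⟨f, hf⟩ := hP g u
  refine ⟨f, fun h => hu₀ ?_, hf ▸ hu'⟩
  rw [h, imageSubobject_zero] at hf
  have h₀ : imageSubobject u₀ = ⊥ := le_bot_iff.1 (hf ▸ hu)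
  have harrow : (imageSubobject u₀).arrow = 0 := by rw [h₀, Subobject.bot_arrow]
  rw [← imageSubobject_arrow_comp u₀, harrow, comp_zero]

lemma exists_pushouts_trivialCofibrationsTo {P : CochainComplex 𝒜 ℤ}
    (hP : DetectsAcyclicQuotients P)
    {A B : CochainComplex 𝒜 ℤ} (p : A ⟶ B) [Mono p] [QuasiIso p] (hp : ¬ IsIso p) :
    ∃ (X : CochainComplex 𝒜 ℤ) (i : A ⟶ X) (p' : X ⟶ B) (_ : (trivialCofibrationsTo P).pushouts i)
      (_ : ¬ IsIso i) (_ : Mono p'), i ≫ p' = p := by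
  obtain ⟨f, hf, hf'⟩ := hP (cokernel.π p) ((quasiIso_iff_acyclic_cokernel p).1 inferInstance)
    (fun h => hp (by
      have : Epi p := Preadditive.epi_of_isZero_cokernel p h
      exact isIso_of_mono_of_epi p))
  let g := f ≫ cokernel.π p
  have hw : pullback.snd p f ≫ g = 0 := by
    rw [← Category.assoc, ← pullback.condition, Category.assoc, cokernel.condition, comp_zero]
  have hw' : pullback.snd p f ≫ factorThruImageSubobject g = 0 := by
    rw [← cancel_mono (imageSubobject g).arrow, Category.assoc, imageSubobject_arrow_comp, hw,
      zero_comp]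
  have hS : (ShortComplex.mk _ _ hw').ShortExact :=
    { exact := by
        refine ShortComplex.exact_of_f_is_kernel _ (KernelFork.IsLimit.ofι' _ _ (fun {W} k hk => ?_))
        have h : (k ≫ f) ≫ cokernel.π p = 0 := by
          have h' := hk =≫ (imageSubobject g).arrow
          rw [zero_comp] at h'
          refine Eq.trans ?_ h'
          refine (Category.assoc _ _ _).trans (Eq.trans ?_ (Category.assoc _ _ _).symm)
          exact k ≫= (imageSubobject_arrow_comp g).symm
        exact ⟨pullback.lift (Abelian.monoLift p _ h) k (Abelian.monoLift_comp _ _ _),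
          pullback.lift_snd _ _ _⟩
      mono_f := inferInstanceAs (Mono (pullback.snd p f))
      epi_g := inferInstanceAs (Epi (factorThruImageSubobject g)) }
  have hq : QuasiIso (pullback.snd p f) := quasiIso_f_of_shortExact hS hf'
  have hmk : QuasiIso (Subobject.mk (pullback.snd p f)).arrow := by
    rw [← Subobject.underlyingIso_hom_comp_eq_mk]
    infer_instance
  refine ⟨pushout (pullback.fst p f) (pullback.snd p f), pushout.inl _ _,
    pushout.desc p f pullback.condition,
    ⟨_, _, _, (Subobject.underlyingIso _).hom ≫ pullback.fst _ _,
    pushout.inr _ _, trivialCofibrationsTo_arrow (Subobject.mk (pullback.snd p f)) hmk,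
    (IsPushout.of_hasPushout (pullback.fst p f) (pullback.snd p f)).of_iso
      ((Subobject.underlyingIso _).symm) (Iso.refl _) (Iso.refl _)
      (Iso.refl _) (by simp) (by simp) (by simp) (by simp)⟩, ?_, ?_, pushout.inl_desc _ _ _⟩
  · intro h
    apply hf
    let i := pushout.inl (pullback.fst p f) (pullback.snd p f)
    let j := pushout.inr (pullback.fst p f) (pullback.snd p f)
    let p' := pushout.desc p f pullback.condition
    have h₂ : i ≫ p' = p := pushout.inl_desc _ _ _
    have h₁ : f = (j ≫ inv i) ≫ p :=
      calc f = j ≫ p' := (pushout.inr_desc _ _ _).symm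
        _ = (j ≫ inv i) ≫ i ≫ p' := by rw [Category.assoc, IsIso.inv_hom_id_assoc]
        _ = _ := by rw [h₂]
    rw [h₁, Category.assoc, cokernel.condition, comp_zero]
  · exact (IsPushout.of_hasPushout _ _).mono_of_isPullback_of_mono
      (IsPullback.of_hasPullback p f) _ (pushout.inl_desc _ _ _) (pushout.inr_desc _ _ _)

end CochainComplex

namespace CategoryTheory.Subobject

variable {C : Type*} [Category.{v} C] [Abelian C] [IsGrothendieckAbelian.{v} C] {X : C}
  {s : Subobject X → Subobject X} {J : Type v} [LinearOrder J] [OrderBot J]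
  [SuccOrder J] [WellFoundedLT J] (A₀ : Subobject X)

lemma monotone_transfiniteIterate_apply (hs : ∀ A, A ≤ s A) :
    Monotone (fun j : J => transfiniteIterate s j A₀) :=
  fun _ _ h => monotone_transfiniteIterate s A₀ hs h

lemma isWellOrderContinuous_functorOfMonotone_transfiniteIterate (hs : ∀ A, A ≤ s A) :
    (functorOfMonotone (monotone_transfiniteIterate_apply (J := J) A₀ hs)).IsWellOrderContinuous where
  nonempty_isColimit m hm := by
    have := hm.nonempty_Iio.to_subtype
    have hI : Monotone (fun j : Set.Iio m => transfiniteIterate s j.1 A₀) :=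
      fun _ _ h => monotone_transfiniteIterate s A₀ hs h
    exact nonempty_isColimit_coconeOfMonotone hI
      (fun j => monotone_transfiniteIterate s A₀ hs j.2.le)
      (transfiniteIterate_limit s A₀ m hm)

lemma transfiniteIterate_induction (hs : ∀ A, A ≤ s A) {p : Subobject X → Prop} (h₀ : p A₀)
    (hsucc : ∀ A, p A → p (s A))
    (hsup : ∀ {K : Type v} [LinearOrder K] [Nonempty K] (I : K → Subobject X) (_ : Monotone I)
      (_ : ∀ k, p (I k)), p (⨆ k, I k)) (j : J) : p (transfiniteIterate s j A₀) := by
  induction j using SuccOrder.limitRecOn with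
  | isMin j hj =>
    obtain rfl := hj.eq_bot
    rwa [transfiniteIterate_bot]
  | succ j hj h =>
    rw [transfiniteIterate_succ _ _ _ hj]
    exact hsucc _ h
  | isSuccLimit j hj h =>
    have := hj.nonempty_Iio.to_subtype
    rw [transfiniteIterate_limit _ _ _ hj]
    exact hsup _ (fun _ _ h => monotone_transfiniteIterate s A₀ hs h) (fun k => h k.1 k.2)

/-- If the inclusions `transfiniteIterate s j A₀ ≤ s (transfiniteIterate s j A₀)` belong to `W`
and the iteration reaches `⊤`, then the inclusion of `A₀` is a transfinite composition
of morphisms in `W`. -/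
lemma transfiniteCompositionsOfShape_arrow (hs : ∀ A, A ≤ s A) {W : MorphismProperty C}
    (hW : ∀ j : J, W (Subobject.ofLE _ _ (hs (transfiniteIterate s j A₀))))
    (htop : ∃ j : J, transfiniteIterate s j A₀ = ⊤) :
    W.transfiniteCompositionsOfShape J A₀.arrow := by
  have hI := monotone_transfiniteIterate_apply (J := J) A₀ hs
  have htop' : (⊤ : Subobject X) = ⨆ j : J, transfiniteIterate s j A₀ := by
    obtain ⟨j, hj⟩ := htop
    exact le_antisymm (hj ▸ le_iSup (fun j : J => transfiniteIterate s j A₀) j) le_top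
  have hub (j : J) : transfiniteIterate s j A₀ ≤ ⊤ := le_top
  obtain ⟨hc⟩ := nonempty_isColimit_coconeOfMonotone hI hub htop'
  have h : W.TransfiniteCompositionOfShape J (Subobject.ofLE A₀ ⊤ le_top) :=
    { F := functorOfMonotone hI
      isWellOrderContinuous := isWellOrderContinuous_functorOfMonotone_transfiniteIterate A₀ hs
      isoBot := Subobject.isoOfEq _ _ (transfiniteIterate_bot _ _)
      incl := (coconeOfMonotone hI hub).ι
      isColimit := hc
      fac := Subobject.ofLE_comp_ofLE _ _ _ _ _
      map_mem j hj := by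
        have aux {B : Subobject X} (hB : B = s (transfiniteIterate s j A₀))
            (h : transfiniteIterate s j A₀ ≤ B) : W (Subobject.ofLE _ _ h) := by
          subst hB
          exact hW j
        exact aux (transfiniteIterate_succ _ _ _ hj) _ }
  let e : Arrow.mk (Subobject.ofLE A₀ ⊤ le_top) ≅ Arrow.mk A₀.arrow :=
    Arrow.isoMk (Iso.refl _) (asIso (⊤ : Subobject X).arrow)
      ((Category.id_comp _).trans (Subobject.ofLE_arrow _).symm)
  exact (h.ofArrowIso e).mem

end CategoryTheory.Subobject

namespace CochainComplex

variable {𝒜 : Type u} [Category.{v} 𝒜] [Abelian 𝒜] [IsGrothendieckAbelian.{v} 𝒜]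

lemma quasiIso_arrow_iSup {X : CochainComplex 𝒜 ℤ} {K : Type v} [LinearOrder K] [Nonempty K]
    (I : K → Subobject X) (hI : Monotone I) (h : ∀ k, QuasiIso (I k).arrow) :
    QuasiIso (⨆ k, I k).arrow := by
  obtain ⟨hc⟩ := Subobject.nonempty_isColimit_coconeOfMonotone hI (le_iSup I) rfl
  let φ : Subobject.functorOfMonotone hI ⟶ (Functor.const K).obj X :=
    { app k := (I k).arrow
      naturality _ _ _ := (Subobject.ofLE_arrow _).trans (Category.comp_id _).symm }
  exact (MorphismProperty.colimitsOfShape_le (W := trivialCofibrations 𝒜) (J := K) _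
    (MorphismProperty.colimitsOfShape.mk' _ _ _ _ hc (isColimitConstCocone K X) φ
      (fun k => ⟨inferInstanceAs (Mono (I k).arrow), h k⟩) (⨆ k, I k).arrow
      (fun k => (Subobject.ofLE_arrow _).trans (Category.comp_id _).symm))).2

lemma exists_larger_subobject {P : CochainComplex 𝒜 ℤ}
    (hP : DetectsAcyclicQuotients P)
    {X : CochainComplex 𝒜 ℤ} (A : Subobject X) (hA : QuasiIso A.arrow) :
    ∃ (A' : Subobject X) (h : A ≤ A'), (A ≠ ⊤ → A < A') ∧ QuasiIso A'.arrow ∧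
      (trivialCofibrationsTo P).pushouts (Subobject.ofLE A A' h) := by
  by_cases hA' : A = ⊤
  · subst hA'
    refine ⟨⊤, le_rfl, fun h => (h rfl).elim, inferInstance, ?_⟩
    rw [Subobject.ofLE_refl]
    exact MorphismProperty.isomorphisms_le_pushouts _
      (fun Z => ⟨_, _, _, trivialCofibrationsTo_arrow ⊤ inferInstance, 0, inferInstance⟩) _
      (MorphismProperty.isomorphisms.infer_property _)
  · obtain ⟨X', i, p', hi, hi', hp', fac⟩ := exists_pushouts_trivialCofibrationsTo hP A.arrow
      (fun h => hA' ((Subobject.isIso_arrow_iff_eq_top A).1 h))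
    have hlt : A < Subobject.mk p' := by
      have := Subobject.mk_lt_mk_of_comm i fac hi'
      rwa [Subobject.mk_arrow] at this
    have hofLE : Subobject.ofLE A (Subobject.mk p') hlt.le =
        i ≫ (Subobject.underlyingIso p').inv := by
      rw [← cancel_mono (Subobject.mk p').arrow, Subobject.ofLE_arrow, Category.assoc,
        Subobject.underlyingIso_arrow, fac]
    refine ⟨Subobject.mk p', hlt.le, fun _ => hlt, ?_, ?_⟩
    · have : QuasiIso i := (trivialCofibrationsTo_pushouts_le P _ hi).2
      have : QuasiIso (i ≫ p') := fac ▸ hA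
      have : QuasiIso p' := quasiIso_of_comp_left i p'
      rw [← Subobject.underlyingIso_hom_comp_eq_mk]
      infer_instance
    · rw [hofLE]
      exact MorphismProperty.RespectsIso.postcomp _ _ _ hi

lemma trivialCofibrationsTo_rlp {P : CochainComplex 𝒜 ℤ}
    (hP : DetectsAcyclicQuotients P) :
    (trivialCofibrationsTo P).rlp = (trivialCofibrations 𝒜).rlp := by
  classical
  refine le_antisymm ?_ (MorphismProperty.antitone_rlp (trivialCofibrationsTo_le P))
  intro Y Z q hq A X i ⟨(_ : Mono i), (_ : QuasiIso i)⟩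
  choose s hs hlt hqi hmem using fun A : { A : Subobject X // QuasiIso A.arrow } =>
    exists_larger_subobject hP A.1 A.2
  let t : Subobject X → Subobject X := fun A => if h : QuasiIso A.arrow then s ⟨A, h⟩ else ⊤
  have ht {A : Subobject X} (h : QuasiIso A.arrow) : t A = s ⟨A, h⟩ := dif_pos h
  have ht' {A : Subobject X} (h : ¬ QuasiIso A.arrow) : t A = ⊤ := dif_neg h
  have hle (A : Subobject X) : A ≤ t A := by
    by_cases h : QuasiIso A.arrow
    · exact (hs ⟨A, h⟩).trans_eq (ht h).symm
    · exact le_top.trans_eq (ht' h).symm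
  have hlt' (A : Subobject X) (hA : A ≠ ⊤) : A < t A := by
    by_cases h : QuasiIso A.arrow
    · exact (hlt ⟨A, h⟩ hA).trans_eq (ht h).symm
    · exact (lt_top_iff_ne_top.2 hA).trans_eq (ht' h).symm
  have hmem' {A : Subobject X} (h : QuasiIso A.arrow) :
      (trivialCofibrationsTo P).pushouts (Subobject.ofLE A (t A) (hle A)) := by
    have aux {B : Subobject X} (hB : B = s ⟨A, h⟩) (hAB : A ≤ B) :
        (trivialCofibrationsTo P).pushouts (Subobject.ofLE A B hAB) := by
      subst hB
      exact hmem ⟨A, h⟩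
    exact aux (ht h) _
  let κ := Order.succ (Cardinal.mk (Shrink.{v} (Subobject X)))
  have : Nonempty κ.ord.ToType := by simp [κ]
  have := WellFoundedLT.toOrderBot κ.ord.ToType
  let A₀ := Subobject.mk i
  have hA₀ : QuasiIso A₀.arrow := by
    rw [← Subobject.underlyingIso_hom_comp_eq_mk]
    infer_instance
  have htop : ∃ j : κ.ord.ToType, transfiniteIterate t j A₀ = ⊤ :=
    top_mem_range_transfiniteIterate t A₀ hlt' (le_antisymm le_top (hle _)) (fun h => by
      have hκ : HasCardinalLT (Subobject X) (Cardinal.mk κ.ord.ToType) :=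
        lt_of_lt_of_le (Order.lt_succ _) (by simp [κ])
      simpa [hasCardinalLT_iff_cardinal_mk_lt] using hκ.of_injective _ h)
  have hind (j : κ.ord.ToType) : QuasiIso (transfiniteIterate t j A₀).arrow :=
    Subobject.transfiniteIterate_induction A₀ hle (p := fun A => QuasiIso A.arrow) hA₀
      (fun A hA => by rw [ht hA]; exact hqi ⟨A, hA⟩) quasiIso_arrow_iSup j
  have hcomp := Subobject.transfiniteCompositionsOfShape_arrow A₀ hle
    (W := (trivialCofibrationsTo P).pushouts) (fun j => hmem' (hind j)) htop
  have : HasLiftingProperty A₀.arrow q :=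
    MorphismProperty.transfiniteCompositionsOfShape_le_llp_rlp _ _ _ hcomp _ (by simpa)
  rw [← Subobject.underlyingIso_arrow i]
  infer_instance

end CochainComplex

namespace CochainComplex

variable {𝒜 : Type u} [Category.{v} 𝒜] [Abelian 𝒜] [IsGrothendieckAbelian.{v} 𝒜]

open MorphismProperty in
instance (P : CochainComplex 𝒜 ℤ) : HasSmallObjectArgument.{v} (trivialCofibrationsTo P) := by
  obtain ⟨κ, hκ', hκ⟩ := HasCardinalLT.exists_regular_cardinal.{v} (Subobject P)
  have : Fact κ.IsRegular := ⟨hκ'⟩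
  have : Nonempty κ.ord.ToType := by simpa using hκ'.ne_zero
  have := WellFoundedLT.toOrderBot κ.ord.ToType
  have : MorphismProperty.IsSmall.{v} (trivialCofibrationsTo P) := by
    dsimp only [trivialCofibrationsTo]
    infer_instance
  exact ⟨κ, inferInstance, inferInstance,
    { preservesColimit {A B X Y} i hi f hf := by
        let hf' : (monomorphisms _).TransfiniteCompositionOfShape κ.ord.ToType f :=
          { toTransfiniteCompositionOfShape := hf.toTransfiniteCompositionOfShape
            map_mem j hj := by
              have := (hf.attachCells j hj).pushouts_coproducts
              simp only [ofHoms_homFamily] at this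
              refine (?_ : _ ≤ monomorphisms _) _ this
              simp only [pushouts_le_iff, coproducts_le_iff]
              exact fun _ _ _ h => (trivialCofibrationsTo_le P _ h).1 }
        have (j j' : κ.ord.ToType) (φ : j ⟶ j') : Mono (hf'.F.map φ) := hf'.mem_map φ
        apply IsGrothendieckAbelian.preservesColimit_coyoneda_obj_of_mono (Y := hf'.F) (κ := κ)
        obtain ⟨S⟩ := hi
        exact Subobject.hasCardinalLT_of_mono hκ S.1.arrow }⟩

lemma trivialCofibrationsTo_llp_le (P : CochainComplex 𝒜 ℤ) :
    (trivialCofibrationsTo P).rlp.llp ≤ trivialCofibrations 𝒜 := by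
  rw [MorphismProperty.llp_rlp_of_hasSmallObjectArgument.{v},
    MorphismProperty.retracts_le_iff, MorphismProperty.transfiniteCompositions_le_iff]
  rw [MorphismProperty.pushouts_le_iff, MorphismProperty.coproducts_le_iff]
  exact trivialCofibrationsTo_le P

lemma exists_factorization_trivialCofibrations {X Y : CochainComplex 𝒜 ℤ} (f : X ⟶ Y) :
    ∃ (Z : CochainComplex 𝒜 ℤ) (i : X ⟶ Z) (p : Z ⟶ Y),
      trivialCofibrations 𝒜 i ∧ (trivialCofibrations 𝒜).rlp p ∧ i ≫ p = f := by
  obtain ⟨P, hP⟩ := exists_detectsAcyclicQuotients 𝒜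
  let h := MorphismProperty.factorizationData (trivialCofibrationsTo P).rlp.llp
    (trivialCofibrationsTo P).rlp f
  exact ⟨h.Z, h.i, h.p, trivialCofibrationsTo_llp_le P _ h.hi,
    trivialCofibrationsTo_rlp hP ▸ h.hp, h.fac⟩

open scoped ZeroObject in
/-- A morphism with the right lifting property with respect to all monomorphisms is a
quasi-isomorphism. -/
lemma quasiIso_of_rlp_monomorphisms {X Y : CochainComplex 𝒜 ℤ} (p : X ⟶ Y)
    (hp : (MorphismProperty.monomorphisms _).rlp p) : QuasiIso p := by
  have hepi : Epi p := by
    have : HasLiftingProperty (0 : (0 : CochainComplex 𝒜 ℤ) ⟶ Y) p :=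
      hp _ (inferInstanceAs (Mono (0 : (0 : CochainComplex 𝒜 ℤ) ⟶ Y)))
    have sq : CommSq (0 : (0 : CochainComplex 𝒜 ℤ) ⟶ X) 0 p (𝟙 Y) := ⟨by rw [zero_comp, zero_comp]⟩
    exact epi_of_epi_fac (sq.fac_right)
  refine quasiIso_of_acyclic_kernel p ?_
  let i := mappingCone.inr (𝟙 (kernel p))
  have : HasLiftingProperty i p := hp _ (mono_mappingCone_inr _)
  have sq : CommSq (kernel.ι p) i p 0 := ⟨by rw [kernel.condition, comp_zero]⟩
  refine Acyclic.of_retract i (kernel.lift p sq.lift sq.fac_right) ?_ (acyclic_mappingCone_id _)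
  rw [← cancel_mono (kernel.ι p), Category.assoc, kernel.lift_ι, sq.fac_left, Category.id_comp]

end CochainComplex

lemma IsRetractOfMap.of_property {C : Type*} [Category* C] {W : MorphismProperty C}
    [W.IsStableUnderRetracts] {X Y X' Y' : C} {f : X ⟶ Y} {g : X' ⟶ Y'}
    (h : IsRetractOfMap f g) (hg : W g) : W f := by
  obtain ⟨iX, iY, rX, rY, h₁, h₂, h₃, h₄⟩ := h
  exact W.of_retract
    { i := Arrow.homMk iX iY h₃
      r := Arrow.homMk rX rY h₄
      retract := by ext <;> assumption } hg

/-- if `𝒜` is a Grothendieck abelian category (cocomplete abelian with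
exact filtered colimits and a separator), then the category of cochain complexes
`CochainComplex 𝒜 ℤ` admits a model structure whose cofibrations are exactly the
monomorphisms and whose weak equivalences are exactly the quasi-isomorphisms. -/
theorem injective_model_structure_of_grothendieck_abelian
    (𝒜 : Type u) [Category.{v} 𝒜] [Abelian 𝒜] [HasColimits 𝒜] [AB5 𝒜]
    (G : 𝒜) (hG : IsSeparator G) :
    ∃ (Cof Fib W : MorphismProperty (CochainComplex 𝒜 ℤ)),
      IsModelStructure (CochainComplex 𝒜 ℤ) Cof Fib W ∧
      (∀ {X Y : CochainComplex 𝒜 ℤ} (f : X ⟶ Y), Cof f ↔ Mono f) ∧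
      (∀ {X Y : CochainComplex 𝒜 ℤ} (f : X ⟶ Y), W f ↔ QuasiIso f) := by
  have : IsGrothendieckAbelian.{v} 𝒜 := { hasSeparator := ⟨G, hG⟩ }
  let Cof := MorphismProperty.monomorphisms (CochainComplex 𝒜 ℤ)
  let W := HomologicalComplex.quasiIso 𝒜 (ComplexShape.up ℤ)
  let Fib := (CochainComplex.trivialCofibrations 𝒜).rlp
  have hW {X Y : CochainComplex 𝒜 ℤ} (p : X ⟶ Y) (hp : Cof.rlp p) : Fib p ∧ W p :=
    ⟨MorphismProperty.antitone_rlp (fun _ _ _ h => h.1) _ hp,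
      CochainComplex.quasiIso_of_rlp_monomorphisms p hp⟩
  have hfact {X Y : CochainComplex 𝒜 ℤ} (f : X ⟶ Y) : ∃ (Z : CochainComplex 𝒜 ℤ) (i : X ⟶ Z)
      (p : Z ⟶ Y), Cof i ∧ Cof.rlp p ∧ i ≫ p = f := by
    let h := IsGrothendieckAbelian.monoMapFactorizationDataRlp f
    exact ⟨h.Z, h.i, h.p, h.hi, h.hp, h.fac⟩
  refine ⟨Cof, Fib, W, ?_, fun _ => Iff.rfl, fun _ => Iff.rfl⟩
  exact {
    weq_comp f g hf hg := W.comp_mem f g hf hg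
    weq_of_comp_left f g hf hfg := W.of_precomp f g hf hfg
    weq_of_comp_right f g hg hfg := W.of_postcomp f g hg hfg
    cof_retract _ _ h := h.of_property
    fib_retract _ _ h := h.of_property
    weq_retract _ _ h := h.of_property
    lift_cof_trivFib {A B X Y} i p hi hp hp' := by
      obtain ⟨Z, j, q, hj, hq, fac⟩ := hfact p
      have hj' : W j := W.of_postcomp j q (hW q hq).2 (fac ▸ hp')
      have : HasLiftingProperty j p := hp j ⟨hj, hj'⟩
      have sq : CommSq (𝟙 X) j p q := ⟨by rw [Category.id_comp, fac]⟩
      exact Cof.rlp.of_retract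
        { i := Arrow.homMk j (𝟙 Y) (by simp [fac])
          r := Arrow.homMk sq.lift (𝟙 Y) (by simp)
          retract := by ext <;> simp } hq i hi
    lift_trivCof_fib i p hi hi' hp := hp i ⟨hi, hi'⟩
    fact_cof_trivFib f := by
      obtain ⟨Z, i, p, hi, hp, fac⟩ := hfact f
      exact ⟨Z, i, p, hi, (hW p hp).1, (hW p hp).2, fac⟩
    fact_trivCof_fib f := by
      obtain ⟨Z, i, p, hi, hp, fac⟩ := CochainComplex.exists_factorization_trivialCofibrations f
      exact ⟨Z, i, p, hi.1, hi.2, hp, fac⟩ }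
end

section
/- Let 𝒜 be a bicomplete abelian category in which every object is injective (a bicomplete semisimple abelian category). Then the category C(𝒜) of cochain complexes in 𝒜 admits a model structure in which the cofibrations are exactly the monomorphisms, the fibrations are exactly the epimorphisms, and the weak equivalences are exactly the quasi-isomorphisms. In particular every object of C(𝒜) is both fibrant and cofibrant. -/
open CategoryTheory CategoryTheory.Limits

universe v u

open HomologicalComplex CochainComplex CochainComplex.HomComplex

namespace CochainComplex

variable {C : Type u} [Category.{v} C] [Abelian C]

/-- An acyclic complex whose terms and cycles are all injective is contractible. -/
lemma nonempty_homotopy_id_zero_of_acyclic {K : CochainComplex C ℤ}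
    [∀ n, Injective (K.X n)] (hcycles : ∀ n, Injective (K.cycles n)) (hK : K.Acyclic) :
    Nonempty (Homotopy (𝟙 K) 0) := by
  let e (n : ℤ) : K.X n ⟶ K.X n := Injective.factorThru (𝟙 _) (K.iCycles n) ≫ K.iCycles n
  have he (n m : ℤ) : K.d n m ≫ e m = K.d n m := by
    simp only [e, ← K.toCycles_i n m, Category.assoc, Injective.comp_factorThru_assoc,
      Category.id_comp]
  have he' (n m : ℤ) : e n ≫ K.d n m = 0 := by simp [e]
  have hsection (n p : ℤ) (hnp : n + 1 = p) :
      ∃ s : K.X p ⟶ K.X n, K.d n p ≫ s = 𝟙 _ - e n := by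
    have hexact : (K.sc' (n - 1) n p).Exact :=
      (K.exactAt_iff' _ n p (by simp) (by simpa)).1 (hK n)
    have hzero : K.d (n - 1) n ≫ (𝟙 _ - e n) = 0 := by simp [he]
    exact ⟨hexact.descToInjective _ hzero, hexact.comp_descToInjective _ _⟩
  choose s hs using hsection
  have hsd (m n : ℤ) (hmn : m + 1 = n) :
      e n ≫ s m n hmn ≫ K.d m n = e n := by
    have : Epi (K.toCycles m n) := by
      obtain rfl : m = (ComplexShape.up ℤ).prev n := by simp; lia
      have h : (K.sc n).toCycles = K.toCycles _ n :=
        (cancel_mono (K.iCycles n)).1 ((K.sc n).toCycles_i.trans (K.toCycles_i _ _).symm)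
      exact h ▸ (hK n).epi_toCycles
    have h : K.iCycles n ≫ s m n hmn ≫ K.d m n = K.iCycles n := by
      rw [← cancel_epi (K.toCycles m n), K.toCycles_i_assoc, K.toCycles_i, ← Category.assoc, hs,
        Preadditive.sub_comp, he', Category.id_comp, sub_zero]
    simp [e, h]
  let α : Cochain K K (-1) := Cochain.mk fun p q hpq ↦ e p ≫ s q p (by lia)
  refine ⟨(Cochain.equivHomotopy _ _).symm ⟨α, ?_⟩⟩
  ext n
  rw [Cochain.ofHom_zero, add_zero, δ_v (-1) 0 (neg_add_cancel 1) α n n (by lia) (n - 1) (n + 1)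
    rfl (by lia)]
  simp [α, hsd (n - 1) n (by lia), reassoc_of% he, hs]

lemma isKInjective_of_forall_injective (hC : ∀ A : C, Injective A) (L : CochainComplex C ℤ) :
    L.IsKInjective where
  nonempty_homotopy_zero {K} f hK := by
    have := fun n ↦ hC (K.X n)
    obtain ⟨h⟩ := nonempty_homotopy_id_zero_of_acyclic (fun n ↦ hC (K.cycles n)) hK
    exact ⟨(Homotopy.ofEq (by simp)).trans ((h.compRight f).trans (Homotopy.ofEq (by simp)))⟩

lemma epiWithInjectiveKernel_f (hC : ∀ A : C, Injective A) {X Y : CochainComplex C ℤ}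
    (p : X ⟶ Y) [Epi p] (n : ℤ) : Abelian.epiWithInjectiveKernel (p.f n) :=
  ⟨inferInstance, hC _⟩

lemma hasLiftingProperty_of_forall_injective (hC : ∀ A : C, Injective A)
    {A B X Y : CochainComplex C ℤ} (i : A ⟶ B) (p : X ⟶ Y) [Mono i] [Epi p]
    (hip : QuasiIso i ∨ QuasiIso p) : HasLiftingProperty i p where
  sq_hasLift {t b} sq := by
    have sq' (n : ℤ) : CommSq (t.f n) (i.f n) (p.f n) (b.f n) :=
      sq.map (HomologicalComplex.eval _ _ n)
    have (n : ℤ) : (sq' n).HasLift := by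
      have := (epiWithInjectiveKernel_f hC p n).hasLiftingProperty (i.f n)
      infer_instance
    let β : Cocycle (cokernel i) (kernel p) 1 :=
      Lifting.cocycle₁ sq (fun n ↦
        { l := (sq' n).lift, fac_left := (sq' n).fac_left, fac_right := (sq' n).fac_right })
        (cokernelIsCokernel i) (kernelIsKernel p) (hπ := by simp) (hι := by simp)
    have := isKInjective_of_forall_injective hC (kernel p)
    obtain ⟨α, hα⟩ : ∃ α : Cochain (cokernel i) (kernel p) 0, δ 0 1 α = β.1 := by
      cases hip
      · refine IsKInjective.eq_δ_of_cocycle β ?_ 0 (by simp)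
        have : (ShortComplex.mk _ _ (cokernel.condition i)).ShortExact :=
          { exact := ShortComplex.exact_cokernel i }
        exact this.acyclic_X₃ (by dsimp; infer_instance)
      · refine IsKInjective.eq_δ_of_cocycle' β ?_ 0 (by simp)
        have : (ShortComplex.mk _ _ (kernel.condition p)).ShortExact :=
          { exact := ShortComplex.exact_kernel p }
        exact this.acyclic_X₁ (by dsimp; infer_instance)
    exact Lifting.hasLift sq _ (cokernelIsCokernel _) (kernelIsKernel _) α hα

lemma quasiIso_biprod_inl {P : CochainComplex C ℤ} (h : Homotopy (𝟙 P) 0)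
    (X : CochainComplex C ℤ) : QuasiIso (biprod.inl : X ⟶ X ⊞ P) := by
  let e : HomotopyEquiv X (X ⊞ P) :=
    { hom := biprod.inl
      inv := biprod.fst
      homotopyHomInvId := Homotopy.ofEq (by simp)
      homotopyInvHomId :=
        ((Homotopy.ofEq (by simp)).trans (Homotopy.add
          (Homotopy.refl (biprod.fst ≫ biprod.inl : X ⊞ P ⟶ X ⊞ P))
          ((h.compRight (biprod.inr : _ ⟶ X ⊞ P)).compLeft (biprod.snd : X ⊞ P ⟶ _)).symm)).trans
        (Homotopy.ofEq (by simp)) }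
  exact e.quasiIso_hom

/-- The mapping cocone of the identity is contractible. -/
noncomputable def homotopyMappingCoconeId (Y : CochainComplex C ℤ) :
    Homotopy (𝟙 (mappingCocone (𝟙 Y))) 0 :=
  let h : Homotopy (𝟙 (mappingCone (𝟙 Y))) 0 :=
    mappingCone.liftHomotopy _ _ _ (mappingCone.snd _) 0 (by simp) (by simp)
  (Homotopy.ofEq ((shiftFunctor _ (-1 : ℤ)).map_id _).symm).trans
    ((h.shift (-1)).trans (Homotopy.ofEq ((shiftFunctor _ (-1 : ℤ)).map_zero _ _)))

lemma exists_fac_mono_quasiIso_epi {X Y : CochainComplex C ℤ} (f : X ⟶ Y) :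
    ∃ (Z : CochainComplex C ℤ) (i : X ⟶ Z) (p : Z ⟶ Y),
      Mono i ∧ QuasiIso i ∧ Epi p ∧ i ≫ p = f := by
  have : Epi (mappingCocone.fst (𝟙 Y)) :=
    epi_of_epi_f _ fun n ↦ epi_of_epi_fac (mappingCocone.inl_v_fst_f (𝟙 Y) n)
  exact ⟨X ⊞ mappingCocone (𝟙 Y), biprod.inl, biprod.desc f (mappingCocone.fst _),
    inferInstance, quasiIso_biprod_inl (homotopyMappingCoconeId Y) X,
    epi_of_epi_fac (biprod.inr_desc f (mappingCocone.fst (𝟙 Y))), by simp⟩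

end CochainComplex

lemma IsRetractOfMap.nonempty_retractArrow {C : Type u} [Category.{v} C] {X Y X' Y' : C}
    {f : X ⟶ Y} {g : X' ⟶ Y'} (h : IsRetractOfMap f g) : Nonempty (RetractArrow f g) := by
  obtain ⟨iX, iY, rX, rY, hX, hY, hi, hr⟩ := h
  exact ⟨{ i := Arrow.homMk iX iY hi
           r := Arrow.homMk rX rY hr
           retract := by ext <;> simp [hX, hY] }⟩

lemma IsRetractOfMap.of_isStableUnderRetracts {C : Type u} [Category.{v} C] {X Y X' Y' : C}
    {f : X ⟶ Y} {g : X' ⟶ Y'} (h : IsRetractOfMap f g) {P : MorphismProperty C}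
    [P.IsStableUnderRetracts] (hg : P g) : P f :=
  h.nonempty_retractArrow.elim fun r ↦ MorphismProperty.of_retract r hg

/-- if `𝒜` is a bicomplete abelian category in which every object is
injective (a bicomplete semisimple abelian category), then `CochainComplex 𝒜 ℤ`
admits a model structure whose cofibrations are exactly the monomorphisms, whose
fibrations are exactly the epimorphisms, and whose weak equivalences are exactly
the quasi-isomorphisms.  In particular, every object is both fibrant (the map to
the terminal object is a fibration) and cofibrant (the map from the initial object
is a cofibration). -/
theorem model_structure_of_semisimple_abelian
    (𝒜 : Type u) [Category.{v} 𝒜] [Abelian 𝒜] [HasLimits 𝒜] [HasColimits 𝒜]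
    (hsemi : ∀ A : 𝒜, Injective A) :
    ∃ (Cof Fib W : MorphismProperty (CochainComplex 𝒜 ℤ)),
      IsModelStructure (CochainComplex 𝒜 ℤ) Cof Fib W ∧
      (∀ {X Y : CochainComplex 𝒜 ℤ} (f : X ⟶ Y), Cof f ↔ Mono f) ∧
      (∀ {X Y : CochainComplex 𝒜 ℤ} (f : X ⟶ Y), Fib f ↔ Epi f) ∧
      (∀ {X Y : CochainComplex 𝒜 ℤ} (f : X ⟶ Y), W f ↔ QuasiIso f) ∧
      (∀ X : CochainComplex 𝒜 ℤ, Cof (initial.to X)) ∧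
      (∀ X : CochainComplex 𝒜 ℤ, Fib (terminal.from X)) := by
  have : EnoughInjectives 𝒜 := ⟨fun A ↦ ⟨{ J := A, injective := hsemi A, f := 𝟙 A }⟩⟩
  refine ⟨.monomorphisms _, .epimorphisms _, HomologicalComplex.quasiIso _ _, ?_,
    fun _ ↦ Iff.rfl, fun _ ↦ Iff.rfl, fun _ ↦ Iff.rfl,
    fun X ↦ ⟨fun _ _ _ ↦ ((isZero_zero _).of_iso
      (initialIsInitial.uniqueUpToIso (isZero_zero _).isInitial)).eq_of_tgt _ _⟩,
    fun X ↦ ⟨fun _ _ _ ↦ ((isZero_zero _).of_iso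
      (terminalIsTerminal.uniqueUpToIso (isZero_zero _).isTerminal)).eq_of_src _ _⟩⟩
  exact
    { weq_comp f g hf hg := MorphismProperty.comp_mem _ f g hf hg
      weq_of_comp_left f g hf hfg := MorphismProperty.of_precomp _ f g hf hfg
      weq_of_comp_right f g hg hfg := MorphismProperty.of_postcomp _ f g hg hfg
      cof_retract _ _ h hg := h.of_isStableUnderRetracts hg
      fib_retract _ _ h hg := h.of_isStableUnderRetracts hg
      weq_retract _ _ h hg := h.of_isStableUnderRetracts hg
      lift_cof_trivFib i p (_ : Mono i) (_ : Epi p) hp :=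
        hasLiftingProperty_of_forall_injective hsemi i p (Or.inr hp)
      lift_trivCof_fib i p (_ : Mono i) hi (_ : Epi p) :=
        hasLiftingProperty_of_forall_injective hsemi i p (Or.inl hi)
      fact_cof_trivFib {X Y} f := ⟨_, cm5b.i f, cm5b.p X Y,
        inferInstanceAs (Mono _), (cm5b.degreewiseEpiWithInjectiveKernel_p X Y).epi,
        inferInstanceAs (QuasiIso _), cm5b.fac f⟩
      fact_trivCof_fib f := exists_fac_mono_quasiIso_epi f }
end

section
/- Let 𝒜 be an abelian category in which every object is injective (a semisimple abelian category). Then every quasi-isomorphism in the category C(𝒜) of cochain complexes in 𝒜 is a homotopy equivalence. -/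
open CategoryTheory CategoryTheory.Limits

universe v u

/-- If every object is injective, every morphism is von Neumann regular. -/
lemma exists_comp_comp_eq_of_forall_injective {𝒜 : Type u} [Category.{v} 𝒜] [Abelian 𝒜]
    (hsemi : ∀ A : 𝒜, Injective A) {A B : 𝒜} (d : A ⟶ B) :
    ∃ s : B ⟶ A, d ≫ s ≫ d = d := by
  have := hsemi
  let S := ShortComplex.mk (kernel.ι d) d (kernel.condition d)
  have hS : S.Exact := ShortComplex.exact_kernel d
  let r : A ⟶ kernel d := Injective.factorThru (𝟙 _) (kernel.ι d)
  have hr : kernel.ι d ≫ r = 𝟙 _ := Injective.comp_factorThru _ _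
  have hφ : S.f ≫ (𝟙 A - r ≫ kernel.ι d) = 0 := by
    simp [S, reassoc_of% hr]
  refine ⟨hS.descToInjective _ hφ, ?_⟩
  have h : d ≫ hS.descToInjective _ hφ = 𝟙 A - r ≫ kernel.ι d :=
    hS.comp_descToInjective _ hφ
  simp [reassoc_of% h]

/-- In an exact short complex `S`, a morphism killed by `S.g` composes to zero with any morphism
killed by `S.f`. -/
lemma CategoryTheory.ShortComplex.Exact.comp_eq_zero_of_annihilates
    {𝒜 : Type u} [Category.{v} 𝒜] [Abelian 𝒜] {S : ShortComplex 𝒜} (hS : S.Exact)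
    {A B : 𝒜} {φ : A ⟶ S.X₂} {ψ : S.X₂ ⟶ B} (hφ : φ ≫ S.g = 0) (hψ : S.f ≫ ψ = 0) :
    φ ≫ ψ = 0 := by
  have := hS.epi_toCycles
  have h : S.iCycles ≫ ψ = 0 := by
    rw [← cancel_epi S.toCycles]
    simpa using hψ
  rw [← S.liftCycles_i φ hφ, Category.assoc, h, comp_zero]

/-- If every object is injective, every acyclic cochain complex is contractible. -/
lemma CochainComplex.nonempty_homotopy_id_zero_of_acyclic_s2
    {𝒜 : Type u} [Category.{v} 𝒜] [Abelian 𝒜]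
    (hsemi : ∀ A : 𝒜, Injective A) {K : CochainComplex 𝒜 ℤ} (hK : K.Acyclic) :
    Nonempty (Homotopy (𝟙 K) 0) := by
  choose s hs using fun i j ↦ exists_comp_comp_eq_of_forall_injective hsemi (K.d i j)
  let ν : K ⟶ K := Homotopy.nullHomotopicMap' fun i j _ ↦ s j i
  have hν (i j k : ℤ) (hij : i + 1 = j) (hjk : j + 1 = k) :
      ν.f j = K.d j k ≫ s j k + s i j ≫ K.d i j :=
    Homotopy.nullHomotopicMap'_f (c := ComplexShape.up ℤ) hij hjk _
  have sq : (𝟙 K - ν) ≫ (𝟙 K - ν) = 0 := by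
    ext n
    have hn := hν (n - 1) n (n + 1) (by simp) rfl
    have hex := (K.exactAt_iff' (n - 1) n (n + 1) (by simp) (by simp)).1 (hK n)
    have hd : (𝟙 K - ν).f n ≫ K.d n (n + 1) = 0 := by
      simp [hn, Preadditive.sub_comp, Preadditive.add_comp, hs]
    have hd' : K.d (n - 1) n ≫ (𝟙 K - ν).f n = 0 := by
      simp [hn, Preadditive.comp_sub, Preadditive.comp_add, hs]
    exact hex.comp_eq_zero_of_annihilates hd hd'
  have ν_zero : (HomotopyCategory.quotient _ _).map ν = 0 :=
    (HomotopyCategory.quotient_map_eq_zero_iff _).2 ⟨Homotopy.nullHomotopy' _⟩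
  rw [← HomotopyCategory.quotient_map_eq_zero_iff, ← (HomotopyCategory.quotient _ _).map_zero K K,
    ← sq]
  simp [ν_zero]

/-- if `𝒜` is an abelian category in which every object is injective
(a semisimple abelian category), then every quasi-isomorphism in `CochainComplex 𝒜 ℤ`
is a homotopy equivalence: it admits an inverse up to chain homotopy. -/
theorem quasiIso_is_homotopyEquiv_of_semisimple
    (𝒜 : Type u) [Category.{v} 𝒜] [Abelian 𝒜] (hsemi : ∀ A : 𝒜, Injective A)
    {X Y : CochainComplex 𝒜 ℤ} (f : X ⟶ Y) (hf : QuasiIso f) :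
    ∃ g : Y ⟶ X, Nonempty (Homotopy (f ≫ g) (𝟙 X)) ∧ Nonempty (Homotopy (g ≫ f) (𝟙 Y)) := by
  rw [← HomologicalComplex.mem_quasiIso_iff, ← HomotopyCategory.quotient_map_mem_quasiIso_iff,
    HomotopyCategory.quasiIso_eq_trW_subcategoryAcyclic] at hf
  obtain ⟨Z, a, b, hT, hZ⟩ := hf
  obtain ⟨K, rfl⟩ := HomotopyCategory.quotient_obj_surjective Z
  rw [HomotopyCategory.quotient_obj_mem_subcategoryAcyclic_iff_acyclic] at hZ
  have : IsIso ((HomotopyCategory.quotient _ _).map f) :=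
    (Pretriangulated.Triangle.isZero₃_iff_isIso₁ _ hT).1
      ((HomotopyCategory.isZero_quotient_obj_iff K).2
        (CochainComplex.nonempty_homotopy_id_zero_of_acyclic_s2 hsemi hZ))
  have he : HomologicalComplex.homotopyEquivalences _ _ f := by
    rwa [← HomotopyCategory.inverseImage_quotient_isomorphisms]
  obtain ⟨e, rfl⟩ := he
  exact ⟨e.inv, ⟨e.homotopyHomInvId⟩, ⟨e.homotopyInvHomId⟩⟩
end

section
/- Let 𝒜 be an abelian category and let p : X → Y be a morphism in the category C(𝒜) of cochain complexes in 𝒜. If p has the right lifting property with respect to every monomorphism of C(𝒜) that is also a quasi-isomorphism, then p is an epimorphism. -/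
open CategoryTheory CategoryTheory.Limits

universe v u

/-- The complex `X ⟶ X` given by an identity morphism in two consecutive degrees is acyclic. -/
lemma CochainComplex.acyclic_double_id {𝒜 : Type u} [Category.{v} 𝒜] [Abelian 𝒜] (X : 𝒜) {n : ℤ}
    (hn : (ComplexShape.up ℤ).Rel n (n + 1)) :
    (HomologicalComplex.double (𝟙 X) hn).Acyclic := by
  intro k
  have hne : n ≠ n + 1 := by lia
  have : IsIso ((HomologicalComplex.double (𝟙 X) hn).d n (n + 1)) := by
    rw [HomologicalComplex.double_d _ _ hne]
    infer_instance
  by_cases hk₀ : k = n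
  · subst hk₀
    rw [HomologicalComplex.exactAt_iff' _ (k - 1) k (k + 1) (by simp) (by simp),
      ShortComplex.exact_iff_mono _
        (HomologicalComplex.double_d_eq_zero₀ (𝟙 X) hn _ _ (by lia))]
    change Mono ((HomologicalComplex.double (𝟙 X) hn).d k (k + 1))
    infer_instance
  · by_cases hk₁ : k = n + 1
    · subst hk₁
      rw [HomologicalComplex.exactAt_iff' _ n (n + 1) (n + 1 + 1) (by simp) (by simp),
        ShortComplex.exact_iff_epi _
          (HomologicalComplex.double_d_eq_zero₀ (𝟙 X) hn _ _ (by lia))]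
      change Epi ((HomologicalComplex.double (𝟙 X) hn).d n (n + 1))
      infer_instance
    · exact ShortComplex.exact_of_isZero_X₂ _
        (HomologicalComplex.isZero_double_X (𝟙 X) hn _ hk₀ hk₁)

/-- let `𝒜` be an abelian category and `p : X ⟶ Y` a morphism of
`CochainComplex 𝒜 ℤ`.  If `p` has the right lifting property with respect to every
monomorphism of `CochainComplex 𝒜 ℤ` which is also a quasi-isomorphism, then `p`
is an epimorphism. -/
theorem epi_of_rlp_wrt_trivial_cofibrations
    (𝒜 : Type u) [Category.{v} 𝒜] [Abelian 𝒜]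
    {X Y : CochainComplex 𝒜 ℤ} (p : X ⟶ Y)
    (h : ∀ {A B : CochainComplex 𝒜 ℤ} (i : A ⟶ B), Mono i → QuasiIso i →
      HasLiftingProperty i p) :
    Epi p := by
  refine HomologicalComplex.epi_of_epi_f p fun n ↦ ?_
  have hn : (ComplexShape.up ℤ).Rel n (n + 1) := rfl
  let e := HomologicalComplex.evalCompCoyonedaCorepresentableByDoubleId hn (by lia) (Y.X n)
  let D := HomologicalComplex.double (𝟙 (Y.X n)) hn
  let i : HomologicalComplex.zero ⟶ D := 0
  have hzero : IsZero (HomologicalComplex.zero : CochainComplex 𝒜 ℤ) :=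
    HomologicalComplex.isZero_zero
  have hi : QuasiIso i := ⟨fun k ↦ by
    have hk : (HomologicalComplex.zero : CochainComplex 𝒜 ℤ).ExactAt k :=
      ShortComplex.exact_of_isZero_X₂ _ (isZero_zero 𝒜)
    rw [quasiIsoAt_iff_exactAt i k hk]
    exact CochainComplex.acyclic_double_id _ _ k⟩
  have := h i (hzero.mono i) hi
  let g : D ⟶ Y := e.homEquiv.symm (𝟙 (Y.X n))
  have sq : CommSq (0 : HomologicalComplex.zero ⟶ X) i p g := ⟨by simp [i]⟩
  have fac : e.homEquiv sq.lift ≫ p.f n = 𝟙 (Y.X n) := by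
    have := e.homEquiv_comp p sq.lift
    rw [sq.fac_right] at this
    exact this.symm.trans (e.homEquiv.apply_symm_apply _)
  exact epi_of_epi_fac fac
end

section
/- Let 𝒜 be an abelian category and let p : X → Y be a morphism in the category C(𝒜) of cochain complexes in 𝒜. If p has the right lifting property with respect to every monomorphism of C(𝒜), then p is a split epimorphism and a quasi-isomorphism. -/
open CategoryTheory CategoryTheory.Limits
open scoped ZeroObject

universe v u

/-- A morphism of cochain complexes which factors through the mapping cone of an identity
is null-homotopic. -/
noncomputable def Homotopy.ofFactorsThroughMappingConeId
    {C : Type u} [Category.{v} C] [Preadditive C] [HasBinaryBiproducts C]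
    {X Y : CochainComplex C ℤ} (f : X ⟶ Y) (l : CochainComplex.mappingCone (𝟙 X) ⟶ Y)
    (fac : CochainComplex.mappingCone.inr (𝟙 X) ≫ l = f) : Homotopy f 0 :=
  (Homotopy.ofEq (by simp [fac])).trans
    ((((CochainComplex.mappingCone.homotopyToZeroOfId X).compRight l).compLeft
      (CochainComplex.mappingCone.inr (𝟙 X))).trans (Homotopy.ofEq (by simp)))

instance CochainComplex.mappingCone.mono_inr
    {C : Type u} [Category.{v} C] [Preadditive C] [HasBinaryBiproducts C]
    {X Y : CochainComplex C ℤ} (f : X ⟶ Y) : Mono (CochainComplex.mappingCone.inr f) :=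
  have (n : ℤ) : Mono ((CochainComplex.mappingCone.inr f).f n) :=
    mono_of_mono_fac (CochainComplex.mappingCone.inr_f_snd_v f n)
  HomologicalComplex.mono_of_mono_f _ this

/-- let `𝒜` be an abelian category and `p : X ⟶ Y` a morphism of
`CochainComplex 𝒜 ℤ`.  If `p` has the right lifting property with respect to every
monomorphism of `CochainComplex 𝒜 ℤ`, then `p` is a split epimorphism and a
quasi-isomorphism. -/
theorem splitEpi_and_quasiIso_of_rlp_wrt_monos
    (𝒜 : Type u) [Category.{v} 𝒜] [Abelian 𝒜]
    {X Y : CochainComplex 𝒜 ℤ} (p : X ⟶ Y)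
    (h : ∀ {A B : CochainComplex 𝒜 ℤ} (i : A ⟶ B), Mono i → HasLiftingProperty i p) :
    IsSplitEpi p ∧ QuasiIso p := by
  obtain ⟨s, hs⟩ : ∃ s : Y ⟶ X, s ≫ p = 𝟙 Y := by
    have := h (0 : (0 : CochainComplex 𝒜 ℤ) ⟶ Y) inferInstance
    have sq : CommSq (0 : (0 : CochainComplex 𝒜 ℤ) ⟶ X) 0 p (𝟙 Y) := ⟨by simp⟩
    exact ⟨sq.lift, sq.fac_right⟩
  refine ⟨⟨⟨s, hs⟩⟩, ?_⟩
  have := h (CochainComplex.mappingCone.inr (𝟙 X)) inferInstance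
  have sq : CommSq (𝟙 X - p ≫ s) (CochainComplex.mappingCone.inr (𝟙 X)) p 0 :=
    ⟨by simp [hs]⟩
  let e : HomotopyEquiv X Y :=
    { hom := p
      inv := s
      homotopyHomInvId :=
        (Homotopy.equivSubZero.symm
          (Homotopy.ofFactorsThroughMappingConeId _ sq.lift sq.fac_left)).symm
      homotopyInvHomId := Homotopy.ofEq hs }
  exact e.quasiIso_hom
end

section
/- Let 𝒜 be a Grothendieck abelian category, J a small filtered category, and η : F ⇒ G a natural transformation between functors F, G : J → C(𝒜) such that the component η_j is a quasi-isomorphism for every object j of J. Then the induced morphism colim F → colim G on filtered colimits is a quasi-isomorphism. In other words, the class of quasi-isomorphisms in C(𝒜) is stable under filtered colimits. -/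
open CategoryTheory CategoryTheory.Limits

universe v u

section

variable {J C : Type*} [Category* J] [Category* C]

/-- A morphism of short complexes in a functor category is a quasi-isomorphism if all its
evaluations are. -/
lemma CategoryTheory.ShortComplex.quasiIso_of_evaluation [Abelian C]
    {S T : ShortComplex (J ⥤ C)} (φ : S ⟶ T)
    (hφ : ∀ j, ShortComplex.QuasiIso (((evaluation J C).obj j).mapShortComplex.map φ)) :
    ShortComplex.QuasiIso φ := by
  rw [ShortComplex.quasiIso_iff, NatTrans.isIso_iff_isIso_app]
  intro j
  have := (ShortComplex.quasiIso_iff _).1 (hφ j)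
  have h := ShortComplex.mapHomologyIso_inv_naturality φ ((evaluation J C).obj j)
  change IsIso (((evaluation J C).obj j).map (ShortComplex.homologyMap φ))
  rw [Iso.comp_inv_eq, Category.assoc] at h
  rw [h]
  exact IsIso.comp_isIso' inferInstance (IsIso.comp_isIso' this inferInstance)

/-- The canonical isomorphism `H (colimit F) ≅ colimit (F ⋙ H)` is natural in `F`. -/
lemma CategoryTheory.Limits.map_colimMap_preservesColimitIso_hom {D : Type*} [Category* D]
    [HasColimitsOfShape J C] [HasColimitsOfShape J D] (H : C ⥤ D) [PreservesColimitsOfShape J H]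
    {F G : J ⥤ C} (η : F ⟶ G) :
    H.map (colimMap η) ≫ (preservesColimitIso H G).hom =
      (preservesColimitIso H F).hom ≫ colimMap (Functor.whiskerRight η H) := by
  rw [← cancel_epi (preservesColimitIso H F).inv]
  ext j
  simp [← Functor.map_comp_assoc]

/-- The canonical isomorphism `H (colimit F) ≅ colimit (F ⋙ H)` is natural in `H`. -/
lemma CategoryTheory.Limits.preservesColimitIso_hom_colimMap_whiskerLeft {D : Type*} [Category* D]
    {F : J ⥤ C} [HasColimit F] {H K : C ⥤ D} [PreservesColimit F H] [PreservesColimit F K]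
    (α : H ⟶ K) :
    (preservesColimitIso H F).hom ≫ colimMap (Functor.whiskerLeft F α) =
      α.app (colimit F) ≫ (preservesColimitIso K F).hom := by
  rw [← cancel_epi (preservesColimitIso H F).inv]
  ext j
  simp

/-- Taking the colimit of a functor valued in homological complexes commutes with
the formation of the short complex in degree `n`. -/
noncomputable def HomologicalComplex.colimCompShortComplexFunctorIso [Abelian C]
    [HasColimitsOfShape J C] {ι : Type*} (c : ComplexShape ι) (n : ι) :
    colim ⋙ shortComplexFunctor C c n ≅
      (Functor.whiskeringRight J _ _).obj (shortComplexFunctor C c n) ⋙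
        ShortComplex.FunctorEquivalence.inverse J C ⋙ (colim (J := J) (C := C)).mapShortComplex :=
  NatIso.ofComponents
    (fun F ↦ ShortComplex.isoMk
      (preservesColimitIso (eval C c (c.prev n)) F)
      (preservesColimitIso (eval C c n) F)
      (preservesColimitIso (eval C c (c.next n)) F)
      (preservesColimitIso_hom_colimMap_whiskerLeft
        (F := F) (H := eval C c (c.prev n)) (K := eval C c n)
        { app K := K.d _ _, naturality _ _ f := f.comm _ _ })
      (preservesColimitIso_hom_colimMap_whiskerLeft
        (F := F) (H := eval C c n) (K := eval C c (c.next n))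
        { app K := K.d _ _, naturality _ _ f := f.comm _ _ }))
    (fun η ↦ by
      ext
      · exact map_colimMap_preservesColimitIso_hom (eval C c (c.prev n)) η
      · exact map_colimMap_preservesColimitIso_hom (eval C c n) η
      · exact map_colimMap_preservesColimitIso_hom (eval C c (c.next n)) η)

/-- Quasi-isomorphisms are stable under exact colimits. -/
lemma HomologicalComplex.quasiIso_colimMap [Abelian C] [HasColimitsOfShape J C]
    [HasExactColimitsOfShape J C] {ι : Type*} {c : ComplexShape ι}
    {F G : J ⥤ HomologicalComplex C c} (η : F ⟶ G) (hη : ∀ j, QuasiIso (η.app j)) :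
    QuasiIso (colimMap η) := by
  rw [quasiIso_iff]
  intro n
  rw [quasiIsoAt_iff]
  let φ := (ShortComplex.FunctorEquivalence.inverse J C).map
    (Functor.whiskerRight η (shortComplexFunctor C c n))
  have : ShortComplex.QuasiIso φ :=
    ShortComplex.quasiIso_of_evaluation φ fun j ↦ (quasiIsoAt_iff (η.app j) n).1 inferInstance
  have : ShortComplex.QuasiIso ((colim (J := J) (C := C)).mapShortComplex.map φ) :=
    inferInstance
  exact ShortComplex.quasiIso_of_arrow_mk_iso
    ((colim (J := J) (C := C)).mapShortComplex.map φ) _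
    (Arrow.isoMk ((colimCompShortComplexFunctorIso c n).app F)
      ((colimCompShortComplexFunctorIso c n).app G)
      ((colimCompShortComplexFunctorIso c n).hom.naturality η).symm).symm

end

/-- let `𝒜` be a Grothendieck abelian category (cocomplete abelian
with exact filtered colimits and a separator), `J` a small filtered category, and
`η : F ⟶ G` a natural transformation between functors `F G : J ⥤ CochainComplex 𝒜 ℤ`
whose components are all quasi-isomorphisms.  Then the induced morphism
`colim F ⟶ colim G` is a quasi-isomorphism; i.e. quasi-isomorphisms in
`CochainComplex 𝒜 ℤ` are stable under filtered colimits. -/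
theorem quasiIso_stable_under_filtered_colimits
    (𝒜 : Type u) [Category.{v} 𝒜] [Abelian 𝒜] [HasColimits 𝒜] [AB5 𝒜]
    (G₀ : 𝒜) (hG₀ : IsSeparator G₀)
    (J : Type v) [SmallCategory J] [IsFiltered J]
    (F G : J ⥤ CochainComplex 𝒜 ℤ) (η : F ⟶ G)
    (hη : ∀ j : J, QuasiIso (η.app j)) :
    QuasiIso (colimMap η) := by
  have := AB5OfSize.ofShape (C := 𝒜) J
  exact HomologicalComplex.quasiIso_colimMap η hη
end

section
/- Let 𝒜 be a Grothendieck abelian category. Every morphism in the category C(𝒜) of cochain complexes in 𝒜 that has the left lifting property with respect to all epimorphisms of C(𝒜) is a quasi-isomorphism. -/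
open CategoryTheory CategoryTheory.Limits

universe v u

lemma CochainComplex.mappingCone.epi_triangle_mor₃ {C : Type u} [Category.{v} C]
    [Preadditive C] [HasBinaryBiproducts C] {K L : CochainComplex C ℤ} (φ : K ⟶ L) :
    Epi (mappingCone.triangle φ).mor₃ := by
  have (n : ℤ) : Epi ((mappingCone.triangle φ).mor₃.f n) := by
    have : Epi ((mappingCone.inl φ).v (n + 1) n (by lia) ≫
        (mappingCone.triangle φ).mor₃.f n) := by
      rw [mappingCone.inl_v_triangle_mor₃_f]
      exact inferInstanceAs (Epi (-(K.shiftFunctorObjXIso 1 n (n + 1) rfl).symm.hom))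
    exact epi_of_epi ((mappingCone.inl φ).v (n + 1) n _) _
  exact HomologicalComplex.epi_of_epi_f _ this

/-- Every cochain complex is the target of an epimorphism from a contractible complex. -/
lemma CochainComplex.exists_epi_of_contractible {C : Type u} [Category.{v} C]
    [Preadditive C] [HasBinaryBiproducts C] (K : CochainComplex C ℤ) :
    ∃ (L : CochainComplex C ℤ) (p : L ⟶ K), Epi p ∧ Nonempty (Homotopy (𝟙 L) 0) := by
  let e : K⟦(-1 : ℤ)⟧⟦(1 : ℤ)⟧ ≅ K := (shiftFunctorCompIsoId _ (-1 : ℤ) 1 (by lia)).app K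
  exact ⟨mappingCone (𝟙 (K⟦(-1 : ℤ)⟧)), (mappingCone.triangle (𝟙 (K⟦(-1 : ℤ)⟧))).mor₃ ≫ e.hom,
    epi_comp' (mappingCone.epi_triangle_mor₃ _) (have := e.isIso_hom; IsIso.epi_of_iso e.hom),
    ⟨mappingCone.homotopyToZeroOfId _⟩⟩

/-- let `𝒜` be a Grothendieck abelian category (cocomplete abelian
with exact filtered colimits and a separator).  Then every morphism of
`CochainComplex 𝒜 ℤ` which has the left lifting property with respect to all
epimorphisms of `CochainComplex 𝒜 ℤ` is a quasi-isomorphism. -/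
theorem quasiIso_of_llp_wrt_epis
    (𝒜 : Type u) [Category.{v} 𝒜] [Abelian 𝒜] [HasColimits 𝒜] [AB5 𝒜]
    (G₀ : 𝒜) (hG₀ : IsSeparator G₀)
    {A B : CochainComplex 𝒜 ℤ} (i : A ⟶ B)
    (h : ∀ {X Y : CochainComplex 𝒜 ℤ} (p : X ⟶ Y), Epi p → HasLiftingProperty i p) :
    QuasiIso i := by
  obtain ⟨Z, hZ⟩ := HasZeroObject.zero (C := CochainComplex 𝒜 ℤ)
  have := h (0 : A ⟶ Z) (hZ.epi _)
  have sq₁ : CommSq (𝟙 A) i (0 : A ⟶ Z) 0 := ⟨by simp⟩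
  let r : B ⟶ A := sq₁.lift
  have hr : i ≫ r = 𝟙 A := sq₁.fac_left
  obtain ⟨L, p, hp, ⟨hL⟩⟩ := CochainComplex.exists_epi_of_contractible B
  have := h p hp
  have sq₂ : CommSq (0 : A ⟶ L) i p (r ≫ i - 𝟙 B) := ⟨by simp [reassoc_of% hr]⟩
  have hom : Homotopy (r ≫ i - 𝟙 B) 0 :=
    (Homotopy.ofEq (by simp)).trans
      (((hL.compLeft sq₂.lift).compRight p).trans (Homotopy.ofEq (by simp)))
  let e : HomotopyEquiv A B :=
    { hom := i
      inv := r
      homotopyHomInvId := Homotopy.ofEq hr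
      homotopyInvHomId := Homotopy.equivSubZero.symm hom }
  exact ⟨fun n ↦ e.quasiIsoAt_hom n⟩
end

section
/- Let 𝒜 be an abelian category. In the category C(𝒜) of cochain complexes in 𝒜, the pushout of a quasi-isomorphism along a monomorphism is a quasi-isomorphism, and the pullback of a quasi-isomorphism along an epimorphism is a quasi-isomorphism. That is: if in a pushout square the map X → Z is a monomorphism and X → X' is a quasi-isomorphism, then the induced map Z → Z' on pushouts is a quasi-isomorphism; dually, if in a pullback square the map X → Y is an epimorphism and Y' → Y is a quasi-isomorphism, then the induced map on pullbacks is a quasi-isomorphism. -/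
open CategoryTheory CategoryTheory.Limits

universe v u

lemma CategoryTheory.Functor.isIso_map_biprod_map {C D : Type*} [Category* C] [Category* D]
    [Preadditive C] [Preadditive D] [HasBinaryBiproducts C] [HasBinaryBiproducts D]
    (F : C ⥤ D) [F.Additive] {X X' Y Y' : C} (f : X ⟶ X') (g : Y ⟶ Y')
    [IsIso (F.map f)] [IsIso (F.map g)] : IsIso (F.map (biprod.map f g)) := by
  refine ⟨F.map biprod.fst ≫ CategoryTheory.inv (F.map f) ≫ F.map biprod.inl +
    F.map biprod.snd ≫ CategoryTheory.inv (F.map g) ≫ F.map biprod.inr, ?_, ?_⟩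
  · simp only [Preadditive.comp_add, ← F.map_comp_assoc, biprod.map_fst, biprod.map_snd]
    simp only [F.map_comp, Category.assoc, IsIso.hom_inv_id_assoc]
    simp only [← F.map_comp, ← F.map_add, biprod.total, F.map_id]
  · simp only [Preadditive.add_comp, Category.assoc, ← F.map_comp, biprod.inl_map, biprod.inr_map]
    simp only [F.map_comp, IsIso.inv_hom_id_assoc]
    simp only [← F.map_comp, ← F.map_add, biprod.total, F.map_id]

section HomologicalComplex

variable {C ι : Type*} [Category* C] [Abelian C] {c : ComplexShape ι}

lemma HomologicalComplex.quasiIso_biprod_map {K K' L L' : HomologicalComplex C c}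
    (f : K ⟶ K') (g : L ⟶ L') [QuasiIso f] [QuasiIso g] :
    QuasiIso (biprod.map f g) := by
  rw [quasiIso_iff]
  intro i
  rw [quasiIsoAt_iff_isIso_homologyMap]
  have : IsIso ((homologyFunctor C c i).map f) := inferInstanceAs (IsIso (homologyMap f i))
  have : IsIso ((homologyFunctor C c i).map g) := inferInstanceAs (IsIso (homologyMap g i))
  exact (homologyFunctor C c i).isIso_map_biprod_map f g

lemma HomologicalComplex.HomologySequence.quasiIso_τ₁_of_exists_rel
    {S₁ S₂ : ShortComplex (HomologicalComplex C c)} (φ : S₁ ⟶ S₂)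
    (hS₁ : S₁.ShortExact) (hS₂ : S₂.ShortExact) (hc : ∀ j, ∃ i, c.Rel i j)
    (h₂ : QuasiIso φ.τ₂) (h₃ : QuasiIso φ.τ₃) :
    QuasiIso φ.τ₁ := by
  rw [quasiIso_iff]
  intro j
  rw [quasiIsoAt_iff_isIso_homologyMap]
  obtain ⟨i, hij⟩ := hc j
  refine Abelian.isIso_of_epi_of_isIso_of_isIso_of_mono
    (composableArrows₅_exact hS₁ i j hij).δ₀ (composableArrows₅_exact hS₂ i j hij).δ₀
    (ComposableArrows.δ₀Functor.map (mapComposableArrows₅ φ hS₁ hS₂ i j hij)) ?_ ?_ ?_ ?_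
  · exact inferInstanceAs (Epi (homologyMap φ.τ₂ i))
  · exact inferInstanceAs (IsIso (homologyMap φ.τ₃ i))
  · exact inferInstanceAs (IsIso (homologyMap φ.τ₂ j))
  · exact inferInstanceAs (Mono (homologyMap φ.τ₃ j))

end HomologicalComplex

section Abelian

variable {C : Type*} [Category* C] [Abelian C] {X₁ X₂ X₃ X₄ : C}
  {t : X₁ ⟶ X₂} {l : X₁ ⟶ X₃} {r : X₂ ⟶ X₄} {b : X₃ ⟶ X₄}

lemma CategoryTheory.IsPushout.shortExact_shortComplex (h : IsPushout t l r b) [Mono l] :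
    h.shortComplex.ShortExact where
  exact := h.exact_shortComplex
  mono_f := by
    change Mono (biprod.lift t (-l))
    have : biprod.lift t (-l) ≫ (-biprod.snd) = l := by simp
    exact mono_of_mono_fac this
  epi_g := h.epi_shortComplex_g

lemma CategoryTheory.IsPullback.shortExact_shortComplex' (h : IsPullback t l r b) [Epi r] :
    h.shortComplex'.ShortExact where
  exact := h.exact_shortComplex'
  mono_f := h.mono_shortComplex'_f
  epi_g := by
    change Epi (biprod.desc r (-b))
    have : biprod.inl ≫ biprod.desc r (-b) = r := by simp
    exact epi_of_epi_fac this

end Abelian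

section QuasiIso

variable {C ι : Type*} [Category* C] [Abelian C] {c : ComplexShape ι}

/-- The cobase change `g'` of a quasi-isomorphism `f` along a monomorphism `g` is the third
component of a morphism from `X ⟶ X ⊞ Z ⟶ Z` to the short exact sequence
`X ⟶ X' ⊞ Z ⟶ Z'`. -/
lemma HomologicalComplex.quasiIso_of_isPushout {X X' Z Z' : HomologicalComplex C c}
    {f : X ⟶ X'} {g : X ⟶ Z} {f' : X' ⟶ Z'} {g' : Z ⟶ Z'} (h : IsPushout f g f' g')
    [Mono g] [QuasiIso f] : QuasiIso g' := by
  have h₀ : IsPushout (𝟙 X) g g (𝟙 Z) := IsPushout.of_id_fst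
  let φ : h₀.shortComplex ⟶ h.shortComplex :=
    { τ₁ := 𝟙 X
      τ₂ := biprod.map f (𝟙 Z)
      τ₃ := g'
      comm₁₂ := show 𝟙 X ≫ biprod.lift f (-g) = biprod.lift (𝟙 X) (-g) ≫ biprod.map f (𝟙 Z) by
        apply biprod.hom_ext <;> simp
      comm₂₃ := show biprod.map f (𝟙 Z) ≫ biprod.desc f' g' = biprod.desc g (𝟙 Z) ≫ g' by
        apply biprod.hom_ext' <;> simp [h.w] }
  exact HomologySequence.quasiIso_τ₃ φ h₀.shortExact_shortComplex h.shortExact_shortComplex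
    (inferInstanceAs (QuasiIso (𝟙 X))) (quasiIso_biprod_map f (𝟙 Z))

/-- The base change `fst` of a quasi-isomorphism `w` along an epimorphism `p` is the first
component of a morphism from the short exact sequence `P ⟶ X ⊞ Y' ⟶ Y` to
`X ⟶ X ⊞ Y ⟶ Y`. -/
lemma HomologicalComplex.quasiIso_of_isPullback {P X Y Y' : HomologicalComplex C c}
    {fst : P ⟶ X} {snd : P ⟶ Y'} {p : X ⟶ Y} {w : Y' ⟶ Y} (h : IsPullback fst snd p w)
    (hc : ∀ j, ∃ i, c.Rel i j) [Epi p] [QuasiIso w] : QuasiIso fst := by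
  have h₀ : IsPullback (𝟙 X) p p (𝟙 Y) := IsPullback.of_id_fst
  let φ : h.shortComplex' ⟶ h₀.shortComplex' :=
    { τ₁ := fst
      τ₂ := biprod.map (𝟙 X) w
      τ₃ := 𝟙 Y
      comm₁₂ := show fst ≫ biprod.lift (𝟙 X) p = biprod.lift fst snd ≫ biprod.map (𝟙 X) w by
        apply biprod.hom_ext <;> simp [h.w]
      comm₂₃ := show biprod.map (𝟙 X) w ≫ biprod.desc p (-𝟙 Y) = biprod.desc p (-w) ≫ 𝟙 Y by
        apply biprod.hom_ext' <;> simp }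
  exact HomologySequence.quasiIso_τ₁_of_exists_rel φ h.shortExact_shortComplex'
    h₀.shortExact_shortComplex' hc (quasiIso_biprod_map (𝟙 X) w)
    (inferInstanceAs (QuasiIso (𝟙 Y)))

end QuasiIso

/-- in the category `CochainComplex 𝒜 ℤ` over an abelian category `𝒜`,
the pushout of a quasi-isomorphism along a monomorphism is a quasi-isomorphism, and
the pullback of a quasi-isomorphism along an epimorphism is a quasi-isomorphism. -/
theorem quasiIso_pushout_along_mono_and_pullback_along_epi
    (𝒜 : Type u) [Category.{v} 𝒜] [Abelian 𝒜] :
    (∀ {X X' Z Z' : CochainComplex 𝒜 ℤ} (f : X ⟶ X') (g : X ⟶ Z)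
      (f' : X' ⟶ Z') (g' : Z ⟶ Z'), IsPushout f g f' g' →
      Mono g → QuasiIso f → QuasiIso g') ∧
    (∀ {P X Y Y' : CochainComplex 𝒜 ℤ} (fst : P ⟶ X) (snd : P ⟶ Y')
      (p : X ⟶ Y) (w : Y' ⟶ Y), IsPullback fst snd p w →
      Epi p → QuasiIso w → QuasiIso fst) := by
  exact ⟨fun _ _ _ _ h _ _ ↦ HomologicalComplex.quasiIso_of_isPushout h,
    fun _ _ _ _ h _ _ ↦ HomologicalComplex.quasiIso_of_isPullback h
      fun j ↦ ⟨j - 1, by simp⟩⟩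
end
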